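/- arXiv:1504.06280 — 2 statements merged into one kernel-verified Lean document; each statement's English description precedes it below -/
import Mathlib

section
/- Assume p̄ = 1/2 and let v₀ be the almost-sure limiting velocity of the ERW (P_η(lim X_n/n = v₀) = 1). Then v₀ > 0 if and only if δ > 2, and v₀ < 0 if and only if δ̃ > 2. -/
open MeasureTheory Filter Set Matrix ProbabilityTheory
open scoped Classical

noncomputable section

/-- `K` is a (row-)stochastic matrix. -/
def IsStochastic {n : Type*} [Fintype n] (K : Matrix n n ℝ) : Prop :=
  (∀ i j, 0 ≤ K i j) ∧ ∀ i, ∑ j, K i j = 1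

/-- `v` is a probability (row) vector. -/
def IsProbVec {n : Type*} [Fintype n] (v : n → ℝ) : Prop :=
  (∀ i, 0 ≤ v i) ∧ ∑ i, v i = 1

/-- `μ` is a stationary distribution for `K`, i.e. `μ K = μ`. -/
def IsStationaryDist {n : Type*} [Fintype n] (K : Matrix n n ℝ) (μ : n → ℝ) : Prop :=
  IsProbVec μ ∧ Matrix.vecMul μ K = μ

/-- `μ` is the unique stationary distribution of `K` (equivalent, for a finite chain, to `K`
having a unique closed irreducible subset). -/
def HasUniqueStationaryDist {n : Type*} [Fintype n] (K : Matrix n n ℝ) (μ : n → ℝ) : Prop :=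
  IsStationaryDist K μ ∧ ∀ μ' : n → ℝ, IsStationaryDist K μ' → μ' = μ

/-- The vector `𝐫 = (I − K + 2(𝟏−𝐩)μD_{1−p}K)⁻¹ 𝐩 − 𝟏` (critical case `p̄ = 1/2`). -/
def rvec {n : Type*} [Fintype n] [DecidableEq n] (K : Matrix n n ℝ) (μ p : n → ℝ) : n → ℝ :=
  Matrix.mulVec
    (1 - K + (2 : ℝ) •
        Matrix.vecMulVec (fun i => 1 - p i)
          (Matrix.vecMul μ (Matrix.diagonal (fun i => 1 - p i) * K)))⁻¹ p
    - 1

/-- The parameter `ν = 2 + 4 μ D_p K 𝐫` (critical case `p̄ = 1/2`). -/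
def nuVal {n : Type*} [Fintype n] [DecidableEq n] (K : Matrix n n ℝ) (μ p : n → ℝ) : ℝ :=
  2 + 4 * ∑ i, Matrix.vecMul μ (Matrix.diagonal p * K) i * rvec K μ p i

/-- The parameter `δ = 2 (η·𝐫) / ν` (critical case `p̄ = 1/2`). -/
def deltaVal {n : Type*} [Fintype n] [DecidableEq n] (K : Matrix n n ℝ) (μ p η : n → ℝ) : ℝ :=
  2 * (∑ i, η i * rvec K μ p i) / nuVal K μ p

/-- `(Pm, Rc, ξ)` is the averaged law of a Markovian cookie environment together with its
coin tosses: the site processes `(Rc x, ξ x)`, `x ∈ ℤ`, are i.i.d., at each site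
`Rc x` is a Markov chain with transition matrix `K` and initial distribution `η`
(0-based indexing: `Rc x j` is `R^x_{j+1}` of the paper), and conditionally on the
environment the `ξ x j` are independent Bernoulli with success probability `p (Rc x j)`.
This is expressed through the finite-dimensional cylinder probabilities, which
characterize the joint law. -/
def IsCookieEnv {N : ℕ} {Ω : Type*} [MeasurableSpace Ω] (Pm : Measure Ω)
    (K : Matrix (Fin N) (Fin N) ℝ) (p η : Fin N → ℝ)
    (Rc : ℤ → ℕ → Ω → Fin N) (ξ : ℤ → ℕ → Ω → Bool) : Prop :=
  (∀ x j, Measurable (Rc x j)) ∧ (∀ x j, Measurable (ξ x j)) ∧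
    ∀ (S : Finset ℤ) (m : ℕ) (f : ℤ → ℕ → Fin N) (b : ℤ → ℕ → Bool),
      (Pm {ω | ∀ x ∈ S, ∀ j ≤ m, Rc x j ω = f x j ∧ ξ x j ω = b x j}).toReal =
        ∏ x ∈ S,
          (η (f x 0) * (∏ j ∈ Finset.range m, K (f x j) (f x (j + 1))) *
            ∏ j ∈ Finset.range (m + 1), (if b x j then p (f x j) else 1 - p (f x j)))

/-- The history (most recent position first) of the excited random walk driven by the
coin tosses `ξ`: from position `x`, if `x` has been visited `j` times before, the walk
steps right iff `ξ x j` (so `ξ x j` is the outcome of the `(j+1)`-st cookie at `x`). -/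
def walkHist (ξ : ℤ → ℕ → Bool) : ℕ → List ℤ
  | 0 => [0]
  | k + 1 =>
    let h := walkHist ξ k
    let x := h.headI
    (x + (if ξ x (h.tail.count x) then 1 else -1)) :: h

/-- The excited random walk driven by the coin tosses `ξ`, started at `0`. -/
def walk (ξ : ℤ → ℕ → Bool) (k : ℕ) : ℤ := (walkHist ξ k).headI

section FiniteChain

variable {ι : Type*} [Fintype ι] {K : Matrix ι ι ℝ} {μ p : ι → ℝ}

theorem IsStochastic.mulVec_const (hK : IsStochastic K) (c : ℝ) (i : ι) :
    (K *ᵥ fun _ => c) i = c := by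
  simp [Matrix.mulVec, dotProduct, ← Finset.sum_mul, hK.2 i]

theorem IsStochastic.mulVec_mono (hK : IsStochastic K) {u v : ι → ℝ} (h : ∀ i, u i ≤ v i) (i : ι) :
    (K *ᵥ u) i ≤ (K *ᵥ v) i :=
  Finset.sum_le_sum fun j _ => mul_le_mul_of_nonneg_left (h j) (hK.1 i j)

theorem IsStochastic.le_mulVec (hK : IsStochastic K) {v : ι → ℝ} {c : ℝ} (h : ∀ i, c ≤ v i)
    (i : ι) : c ≤ (K *ᵥ v) i := by
  simpa [hK.mulVec_const] using hK.mulVec_mono h i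

theorem IsStochastic.mulVec_le (hK : IsStochastic K) {v : ι → ℝ} {c : ℝ} (h : ∀ i, v i ≤ c)
    (i : ι) : (K *ᵥ v) i ≤ c := by
  simpa [hK.mulVec_const] using hK.mulVec_mono h i

theorem IsStochastic.abs_mulVec_le (hK : IsStochastic K) {v : ι → ℝ} {c : ℝ} (h : ∀ i, |v i| ≤ c)
    (i : ι) : |(K *ᵥ v) i| ≤ c :=
  abs_le.2 ⟨hK.le_mulVec (fun j => (abs_le.1 (h j)).1) i,
    hK.mulVec_le (fun j => (abs_le.1 (h j)).2) i⟩

/-- A closed nonempty set of states carries a stationary distribution. -/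
theorem exists_stationary_of_closed (hK : IsStochastic K) {S : Set ι} (hne : S.Nonempty)
    (hcl : ∀ i ∈ S, ∀ l, l ∉ S → K i l = 0) :
    ∃ π, IsStationaryDist K π ∧ ∀ i, i ∉ S → π i = 0 := by
  obtain ⟨s, hs⟩ := hne
  let Δ : Set (ι → ℝ) := stdSimplex ℝ ι ∩ {v | ∀ i, i ∉ S → v i = 0}
  have hΔc : IsCompact Δ := by
    refine (isCompact_stdSimplex ℝ ι).inter_right ?_
    simp only [Set.ofPred_forall]
    exact isClosed_iInter fun i => isClosed_iInter fun _ =>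
      isClosed_eq (continuous_apply i) continuous_const
  have hΔconv : Convex ℝ Δ := by
    refine (convex_stdSimplex ℝ ι).inter ?_
    intro x hx y hy a b _ _ _ i hi
    simp [hx i hi, hy i hi]
  let v : ℕ → ι → ℝ := fun t => Nat.rec (Pi.single s 1) (fun _ w => w ᵥ* K) t
  have hv1 : ∀ t, v (t + 1) = v t ᵥ* K := fun _ => rfl
  have hv : ∀ t, v t ∈ Δ := by
    intro t
    induction t with
    | zero =>
      refine ⟨single_mem_stdSimplex ℝ s, fun i hi => ?_⟩
      have : i ≠ s := fun h => hi (h ▸ hs)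
      simp [v, this]
    | succ t ih =>
      rw [hv1]
      obtain ⟨⟨h0, h1⟩, h2⟩ := ih
      refine ⟨⟨fun j => Finset.sum_nonneg fun i _ => mul_nonneg (h0 i) (hK.1 i j), ?_⟩, ?_⟩
      · simp only [Matrix.vecMul, dotProduct]
        rw [Finset.sum_comm]
        simp [← Finset.mul_sum, hK.2, h1]
      · intro j hj
        refine Finset.sum_eq_zero fun i _ => ?_
        by_cases hi : i ∈ S
        · simp [hcl i hi j hj]
        · simp [h2 i hi]
  let c : ℕ → ι → ℝ := fun N => ((N : ℝ) + 1)⁻¹ • ∑ t ∈ Finset.range (N + 1), v t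
  have hc : ∀ N, c N ∈ Δ := by
    intro N
    have := hΔconv.sum_mem (t := Finset.range (N + 1)) (w := fun _ => ((N : ℝ) + 1)⁻¹) (z := v)
      (fun _ _ => by positivity) (by simp; field_simp) (fun t _ => hv t)
    simpa [c, Finset.smul_sum] using this
  obtain ⟨π, hπ, φ, hφ, hlim⟩ := hΔc.tendsto_subseq hc
  refine ⟨π, ⟨hπ.1, ?_⟩, hπ.2⟩
  have hdiff : ∀ N j, (c N ᵥ* K) j - c N j = ((N : ℝ) + 1)⁻¹ * (v (N + 1) j - v 0 j) := by
    intro N j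
    have : c N ᵥ* K - c N = ((N : ℝ) + 1)⁻¹ • (v (N + 1) - v 0) := by
      simp only [c]
      rw [Matrix.smul_vecMul, Matrix.sum_vecMul, ← smul_sub, ← Finset.sum_sub_distrib]
      simp only [← hv1]
      rw [Finset.sum_range_sub]
    simpa using congrFun this j
  ext j
  have h1 : Tendsto (fun k => (c (φ k) ᵥ* K) j - c (φ k) j) atTop (nhds ((π ᵥ* K) j - π j)) := by
    have hcont : Continuous fun w : ι → ℝ => (w ᵥ* K) j - w j := by
      simp only [Matrix.vecMul, dotProduct]
      fun_prop
    exact (hcont.tendsto π).comp hlim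
  have h2 : Tendsto (fun k => (c (φ k) ᵥ* K) j - c (φ k) j) atTop (nhds 0) := by
    simp only [hdiff]
    have h3 : Tendsto (fun N : ℕ => ((N : ℝ) + 1)⁻¹) atTop (nhds 0) :=
      tendsto_inv_atTop_zero.comp (tendsto_natCast_atTop_atTop.atTop_add tendsto_const_nhds)
    refine squeeze_zero_norm (fun k => ?_) (h3.comp hφ.tendsto_atTop)
    have hb : ∀ t, v t j ∈ Set.Icc (0 : ℝ) 1 := fun t =>
      ⟨(hv t).1.1 j, by
        rw [← (hv t).1.2]
        exact Finset.single_le_sum (fun i _ => (hv t).1.1 i) (Finset.mem_univ j)⟩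
    have h4 : |v (φ k + 1) j - v 0 j| ≤ 1 := by
      have := hb (φ k + 1)
      have := hb 0
      simp only [Set.mem_Icc] at *
      rw [abs_le]; constructor <;> linarith
    have h5 : (0 : ℝ) ≤ ((φ k : ℝ) + 1)⁻¹ := by positivity
    rw [Real.norm_eq_abs, abs_mul, abs_of_nonneg h5]
    simpa using mul_le_mul_of_nonneg_left h4 h5
  have := tendsto_nhds_unique h1 h2
  linarith

/-- Some state is accessible, in at least one step, from every state. -/
theorem HasUniqueStationaryDist.exists_accessible (hK : IsStochastic K)
    (hμ : HasUniqueStationaryDist K μ) :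
    ∃ j₀, ∀ i, Relation.TransGen (fun a b => 0 < K a b) i j₀ := by
  obtain ⟨⟨hpos, hsum⟩, hst⟩ := hμ.1
  obtain ⟨j₀, hj₀⟩ : ∃ j, μ j ≠ 0 := by
    by_contra! h
    simp [h] at hsum
  refine ⟨j₀, fun i => ?_⟩
  by_contra hi
  obtain ⟨π, hπ, hπS⟩ := exists_stationary_of_closed hK
    (S := {i | ¬ Relation.TransGen (fun a b => 0 < K a b) i j₀}) ⟨i, hi⟩ (by
      intro a ha l hl
      simp only [Set.mem_ofPred_eq, not_not] at ha hl
      by_contra h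
      exact ha (Relation.TransGen.head (lt_of_le_of_ne (hK.1 a l) (Ne.symm h)) hl))
  obtain rfl := hμ.2 π hπ
  have h1 : ∑ a, π a * K a j₀ ≠ 0 := by
    have := congrFun hst j₀
    simp only [Matrix.vecMul, dotProduct] at this
    rwa [this]
  obtain ⟨a, -, ha⟩ := Finset.exists_ne_zero_of_sum_ne_zero h1
  have haS := not_imp_comm.1 (hπS a) (left_ne_zero_of_mul ha)
  exact haS (Relation.TransGen.single (lt_of_le_of_ne (hK.1 a j₀) (right_ne_zero_of_mul ha).symm))

theorem nonneg_of_superharmonic (hK : IsStochastic K) (hp : ∀ i, p i ∈ Set.Ioo (0 : ℝ) 1)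
    {z : ι → ℝ} (hz : ∀ i, (1 - p i) * (K *ᵥ z) i ≤ z i) (i : ι) : 0 ≤ z i := by
  obtain ⟨k, -, hk⟩ := Finset.exists_min_image Finset.univ z ⟨i, Finset.mem_univ i⟩
  have h1 := hK.le_mulVec (fun j => hk j (Finset.mem_univ j)) k
  have h2 := hz k
  have h3 := (hp k).1
  have h4 := (hp k).2
  have h5 : 0 ≤ p k * z k := by nlinarith
  exact (nonneg_of_mul_nonneg_right h5 h3).trans (hk i (Finset.mem_univ i))

/-- Uniform minorization of the chain watched at its successes. -/
theorem exists_minorization (hK : IsStochastic K) (hμ : HasUniqueStationaryDist K μ)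
    (hp : ∀ i, p i ∈ Set.Ioo (0 : ℝ) 1) :
    ∃ j₀, ∃ ε : ℝ, 0 < ε ∧ ε < 1 ∧ ∀ (z : ι → ℝ) (a : ℝ), 0 ≤ a →
      (∀ i, p i * K i j₀ * a + (1 - p i) * (K *ᵥ z) i ≤ z i) → ∀ i, ε * a ≤ z i := by
  obtain ⟨j₀, hj₀⟩ := hμ.exists_accessible hK
  have key : ∀ i, ∃ ε : ℝ, 0 < ε ∧ ∀ (z : ι → ℝ) (a : ℝ), 0 ≤ a →
      (∀ i, p i * K i j₀ * a + (1 - p i) * (K *ᵥ z) i ≤ z i) → ε * a ≤ z i := by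
    have hz0 : ∀ (z : ι → ℝ) (a : ℝ), 0 ≤ a →
        (∀ i, p i * K i j₀ * a + (1 - p i) * (K *ᵥ z) i ≤ z i) → ∀ i, 0 ≤ z i := by
      intro z a ha hz
      refine nonneg_of_superharmonic hK hp fun i => le_trans ?_ (hz i)
      have : 0 ≤ p i * K i j₀ * a := mul_nonneg (mul_nonneg (hp i).1.le (hK.1 i j₀)) ha
      linarith
    intro i
    induction hj₀ i using Relation.TransGen.head_induction_on with
    | single h =>
      rename_i i
      refine ⟨p i * K i j₀, mul_pos (hp i).1 h, fun z a ha hz => le_trans ?_ (hz i)⟩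
      have := hK.le_mulVec (hz0 z a ha hz) i
      have := mul_nonneg (sub_nonneg.2 (hp i).2.le) this
      linarith
    | head h _ ih =>
      rename_i i l _
      obtain ⟨ε, hε, ih⟩ := ih
      refine ⟨(1 - p i) * (K i l * ε), mul_pos (sub_pos.2 (hp i).2) (mul_pos h hε),
        fun z a ha hz => le_trans ?_ (hz i)⟩
      have h1 : K i l * z l ≤ (K *ᵥ z) i :=
        Finset.single_le_sum (f := fun l => K i l * z l)
          (fun j _ => mul_nonneg (hK.1 i j) (hz0 z a ha hz j)) (Finset.mem_univ l)
      have h2 := mul_le_mul_of_nonneg_left (ih z a ha hz) h.le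
      have h3 := mul_le_mul_of_nonneg_left (h2.trans h1) (sub_nonneg.2 (hp i).2.le)
      have : 0 ≤ p i * K i j₀ * a := mul_nonneg (mul_nonneg (hp i).1.le (hK.1 i j₀)) ha
      nlinarith
  choose e he hz using key
  obtain ⟨k, -, hk⟩ := Finset.exists_min_image Finset.univ e ⟨j₀, Finset.mem_univ j₀⟩
  refine ⟨j₀, min (e k) (1 / 2), lt_min (he k) (by norm_num),
    (min_le_right _ _).trans_lt (by norm_num), fun z a ha h i => le_trans ?_ (hz i z a ha h)⟩
  exact mul_le_mul_of_nonneg_right ((min_le_left _ _).trans (hk i (Finset.mem_univ i))) ha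

/-- Iterating the chain watched at its successes flattens every function geometrically. -/
theorem exists_geometric_flattening (hK : IsStochastic K) (hμ : HasUniqueStationaryDist K μ)
    (hp : ∀ i, p i ∈ Set.Ioo (0 : ℝ) 1) :
    ∃ ρ : ℝ, 0 < ρ ∧ ρ < 1 ∧ ∀ x : ℕ → ι → ℝ,
      (∀ m i, x (m + 1) i = p i * (K *ᵥ x m) i + (1 - p i) * (K *ᵥ x (m + 1)) i) →
      ∃ D, ∀ m, ∃ lo hi, hi - lo ≤ D * ρ ^ m ∧ ∀ i, lo ≤ x m i ∧ x m i ≤ hi := by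
  obtain ⟨j₀, ε, hε0, hε1, hmin⟩ := exists_minorization hK hμ hp
  have upper : ∀ (x y : ι → ℝ) (hi : ℝ), (∀ i, x i ≤ hi) →
      (∀ i, y i = p i * (K *ᵥ x) i + (1 - p i) * (K *ᵥ y) i) →
      ∀ i, y i ≤ (1 - ε) * hi + ε * x j₀ := by
    intro x y hi hx hy i
    have h := hmin (fun i => hi - y i) (hi - x j₀) (sub_nonneg.2 (hx j₀)) (fun i => ?_) i
    · linarith
    · have e1 : (K *ᵥ fun i => hi - y i) i = hi - (K *ᵥ y) i := by
        have := congrFun (Matrix.mulVec_sub K (fun _ => hi) y) i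
        simpa [hK.mulVec_const, Pi.sub_def] using this
      have e2 : (K *ᵥ fun i => hi - x i) i = hi - (K *ᵥ x) i := by
        have := congrFun (Matrix.mulVec_sub K (fun _ => hi) x) i
        simpa [hK.mulVec_const, Pi.sub_def] using this
      have h1 : K i j₀ * (hi - x j₀) ≤ (K *ᵥ fun i => hi - x i) i :=
        Finset.single_le_sum (f := fun l => K i l * (hi - x l))
          (fun j _ => mul_nonneg (hK.1 i j) (sub_nonneg.2 (hx j))) (Finset.mem_univ j₀)
      have h2 := mul_le_mul_of_nonneg_left h1 (hp i).1.le
      rw [e1, hy i]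
      rw [e2] at h2
      linarith
  have neg : ∀ (x : ι → ℝ) i, (K *ᵥ fun i => - x i) i = - (K *ᵥ x) i := fun x i =>
    congrFun (Matrix.mulVec_neg x K) i
  refine ⟨1 - ε, by linarith, by linarith, fun x hx => ?_⟩
  obtain ⟨a, -, ha⟩ := Finset.exists_min_image Finset.univ (x 0) ⟨j₀, Finset.mem_univ j₀⟩
  obtain ⟨b, -, hb⟩ := Finset.exists_max_image Finset.univ (x 0) ⟨j₀, Finset.mem_univ j₀⟩
  refine ⟨x 0 b - x 0 a, fun m => ?_⟩
  induction m with
  | zero =>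
    exact ⟨x 0 a, x 0 b, by simp, fun i => ⟨ha i (Finset.mem_univ i), hb i (Finset.mem_univ i)⟩⟩
  | succ m ih =>
    obtain ⟨lo, hi, hD, h⟩ := ih
    refine ⟨(1 - ε) * lo + ε * x m j₀, (1 - ε) * hi + ε * x m j₀, ?_, fun i => ⟨?_, ?_⟩⟩
    · have := mul_le_mul_of_nonneg_left hD (sub_nonneg.2 hε1.le)
      rw [pow_succ]
      linarith
    · have := upper (fun i => - x m i) (fun i => - x (m + 1) i) (-lo)
        (fun i => neg_le_neg (h i).1) (fun i => by rw [neg, neg, hx m i]; ring) i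
      linarith
    · exact upper (x m) (x (m + 1)) hi (fun i => (h i).2) (hx m) i

theorem eq_of_harmonic (hK : IsStochastic K) (hμ : HasUniqueStationaryDist K μ) {v : ι → ℝ}
    (hv : ∀ i, (K *ᵥ v) i = v i) (i j : ι) : v i = v j := by
  obtain ⟨ρ, h0, h1, h⟩ := exists_geometric_flattening (p := fun _ => 1 / 2) hK hμ
    (fun _ => by norm_num)
  obtain ⟨D, hD⟩ := h (fun _ => v) (fun _ i => by rw [hv i]; ring)
  have hle : ∀ m : ℕ, |v i - v j| ≤ D * ρ ^ m := fun m => by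
    obtain ⟨lo, hi, hd, hb⟩ := hD m
    have := hb i
    have := hb j
    exact (abs_le.2 ⟨by linarith, by linarith⟩).trans hd
  have hlim : Tendsto (fun m : ℕ => D * ρ ^ m) atTop (nhds 0) := by
    simpa using (tendsto_pow_atTop_nhds_zero_of_lt_one h0.le h1).const_mul D
  have := ge_of_tendsto' hlim hle
  exact sub_eq_zero.1 (abs_eq_zero.1 (le_antisymm this (abs_nonneg _)))

end FiniteChain

section CriticalParameters

variable {ι : Type*} [Fintype ι] {K : Matrix ι ι ℝ} {μ p : ι → ℝ}

theorem IsStationaryDist.sum_mul_mulVec (hμ : IsStationaryDist K μ) (v : ι → ℝ) :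
    ∑ i, μ i * (K *ᵥ v) i = ∑ i, μ i * v i := by
  have := Matrix.dotProduct_mulVec μ K v
  rw [hμ.2] at this
  simpa [dotProduct] using this

theorem sum_vecMul_diagonal_mul [DecidableEq ι] (μ q v : ι → ℝ) :
    ∑ i, (μ ᵥ* (Matrix.diagonal q * K)) i * v i = ∑ i, μ i * (q i * (K *ᵥ v) i) := by
  have := Matrix.dotProduct_mulVec μ (Matrix.diagonal q * K) v
  rw [← Matrix.mulVec_mulVec] at this
  simpa [dotProduct, Matrix.mulVec_diagonal] using this.symm

/-- The matrix inverted in the definition of `rvec`. -/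
def rvecMatrix [DecidableEq ι] (K : Matrix ι ι ℝ) (μ p : ι → ℝ) : Matrix ι ι ℝ :=
  1 - K + (2 : ℝ) •
    Matrix.vecMulVec (fun i => 1 - p i)
      (Matrix.vecMul μ (Matrix.diagonal (fun i => 1 - p i) * K))

theorem rvecMatrix_mulVec [DecidableEq ι] (u : ι → ℝ) (i : ι) :
    (rvecMatrix K μ p *ᵥ u) i =
      u i - (K *ᵥ u) i + 2 * (1 - p i) * ∑ a, μ a * ((1 - p a) * (K *ᵥ u) a) := by
  rw [← sum_vecMul_diagonal_mul μ (fun i => 1 - p i) u]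
  simp only [rvecMatrix, Matrix.add_mulVec, Matrix.sub_mulVec, Matrix.one_mulVec,
    Matrix.smul_mulVec, Pi.add_apply, Pi.sub_apply, Pi.smul_apply, smul_eq_mul]
  congr 1
  simp only [Matrix.mulVec, Matrix.vecMulVec, dotProduct, Matrix.of_apply, Finset.mul_sum]
  exact Finset.sum_congr rfl fun _ _ => by ring

theorem sum_one_sub_of_crit (hμ : IsStationaryDist K μ) (hcrit : ∑ i, μ i * p i = 1 / 2) :
    ∑ i, μ i * (1 - p i) = 1 / 2 := by
  simp only [mul_sub, mul_one, Finset.sum_sub_distrib, hcrit, hμ.1.2]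
  norm_num

theorem sum_rvecMatrix_mulVec [DecidableEq ι] (hμ : IsStationaryDist K μ)
    (hcrit : ∑ i, μ i * p i = 1 / 2) (u : ι → ℝ) :
    ∑ i, μ i * (rvecMatrix K μ p *ᵥ u) i = ∑ a, μ a * ((1 - p a) * (K *ᵥ u) a) := by
  simp only [rvecMatrix_mulVec]
  set W := ∑ a, μ a * ((1 - p a) * (K *ᵥ u) a)
  have h1 : ∀ i, μ i * (u i - (K *ᵥ u) i + 2 * (1 - p i) * W) =
      μ i * u i - μ i * (K *ᵥ u) i + μ i * (1 - p i) * (2 * W) := fun i => by ring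
  simp only [h1, Finset.sum_add_distrib, Finset.sum_sub_distrib, hμ.sum_mul_mulVec,
    ← Finset.sum_mul, sum_one_sub_of_crit hμ hcrit]
  ring

theorem isUnit_rvecMatrix [DecidableEq ι] (hK : IsStochastic K) (hμ : HasUniqueStationaryDist K μ)
    (hcrit : ∑ i, μ i * p i = 1 / 2) : IsUnit (rvecMatrix K μ p) := by
  rw [← Matrix.mulVec_injective_iff_isUnit]
  refine (injective_iff_map_eq_zero (Matrix.mulVecLin (rvecMatrix K μ p))).2 fun u hu => ?_
  have hu' : ∀ i, (rvecMatrix K μ p *ᵥ u) i = 0 := fun i => congrFun hu i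
  have hW := sum_rvecMatrix_mulVec hμ.1 hcrit u
  simp only [hu', mul_zero, Finset.sum_const_zero] at hW
  have hh : ∀ i, (K *ᵥ u) i = u i := fun i => by
    have := hu' i
    rw [rvecMatrix_mulVec, ← hW] at this
    linarith
  ext i
  simp only [hh, fun a => eq_of_harmonic hK hμ hh a i, ← mul_assoc, ← Finset.sum_mul,
    sum_one_sub_of_crit hμ.1 hcrit] at hW
  simp only [Pi.zero_apply]
  linarith

theorem rvecMatrix_mulVec_inv [DecidableEq ι] (hK : IsStochastic K)
    (hμ : HasUniqueStationaryDist K μ) (hcrit : ∑ i, μ i * p i = 1 / 2) (y : ι → ℝ) :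
    rvecMatrix K μ p *ᵥ ((rvecMatrix K μ p)⁻¹ *ᵥ y) = y := by
  rw [Matrix.mulVec_mulVec, Matrix.mul_nonsing_inv _
    ((Matrix.isUnit_iff_isUnit_det _).1 (isUnit_rvecMatrix hK hμ hcrit)), Matrix.one_mulVec]

/-- Solvability of the Poisson equation for a centred right-hand side. -/
theorem exists_poisson [DecidableEq ι] (hK : IsStochastic K) (hμ : HasUniqueStationaryDist K μ)
    (hcrit : ∑ i, μ i * p i = 1 / 2) {y : ι → ℝ} (hy : ∑ i, μ i * y i = 0) :
    ∃ h : ι → ℝ, ∀ i, h i - (K *ᵥ h) i = y i := by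
  have hM := rvecMatrix_mulVec_inv hK hμ hcrit y
  have hW := sum_rvecMatrix_mulVec hμ.1 hcrit ((rvecMatrix K μ p)⁻¹ *ᵥ y)
  rw [hM, hy] at hW
  refine ⟨(rvecMatrix K μ p)⁻¹ *ᵥ y, fun i => ?_⟩
  have := congrFun hM i
  rw [rvecMatrix_mulVec, ← hW] at this
  linarith

theorem mulVec_add_const (hK : IsStochastic K) (v : ι → ℝ) (c : ℝ) (i : ι) :
    (K *ᵥ fun j => v j + c) i = (K *ᵥ v) i + c := by
  have := congrFun (Matrix.mulVec_add K v fun _ => c) i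
  simpa [hK.mulVec_const, Pi.add_def] using this

theorem rvec_eq_iff [DecidableEq ι] (hK : IsStochastic K) (hμ : HasUniqueStationaryDist K μ)
    (hcrit : ∑ i, μ i * p i = 1 / 2) (r : ι → ℝ) :
    rvec K μ p = r ↔ (∀ i, r i - (K *ᵥ r) i = 2 * p i - 1) ∧
      ∑ a, μ a * ((1 - p a) * (K *ᵥ r) a) = 0 := by
  have hhalf := sum_one_sub_of_crit hμ.1 hcrit
  have hshift : ∑ a, μ a * ((1 - p a) * (K *ᵥ fun j => r j + 1) a) =
      ∑ a, μ a * ((1 - p a) * (K *ᵥ r) a) + 1 / 2 := by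
    simp only [mulVec_add_const hK, mul_add, mul_one, Finset.sum_add_distrib, hhalf]
  have hiff : rvec K μ p = r ↔ rvecMatrix K μ p *ᵥ (fun j => r j + 1) = p := by
    have hinv := rvecMatrix_mulVec_inv hK hμ hcrit p
    have hdef : rvec K μ p = (rvecMatrix K μ p)⁻¹ *ᵥ p - 1 := rfl
    constructor
    · rintro rfl
      convert hinv using 2
      ext j
      simp [hdef]
    · intro h
      have := Matrix.mulVec_injective_iff_isUnit.2 (isUnit_rvecMatrix hK hμ hcrit) (hinv.trans h.symm)
      rw [hdef, this]
      ext j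
      simp
  rw [hiff]
  constructor
  · intro h
    have hW := sum_rvecMatrix_mulVec hμ.1 hcrit fun j => r j + 1
    rw [h, hcrit] at hW
    refine ⟨fun i => ?_, by linarith⟩
    have := congrFun h i
    rw [rvecMatrix_mulVec, ← hW, mulVec_add_const hK] at this
    linarith
  · rintro ⟨h1, h2⟩
    ext i
    rw [rvecMatrix_mulVec, hshift, h2, mulVec_add_const hK]
    linarith [h1 i]

theorem sum_success_mulVec (hμ : IsStationaryDist K μ) {r : ι → ℝ}
    (hr : ∑ a, μ a * ((1 - p a) * (K *ᵥ r) a) = 0) :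
    ∑ a, μ a * (p a * (K *ᵥ r) a) = ∑ a, μ a * r a := by
  rw [← hμ.sum_mul_mulVec r, ← add_zero (∑ a, μ a * (p a * (K *ᵥ r) a)), ← hr,
    ← Finset.sum_add_distrib]
  exact Finset.sum_congr rfl fun _ _ => by ring

theorem nuVal_eq [DecidableEq ι] (hK : IsStochastic K) (hμ : HasUniqueStationaryDist K μ)
    (hcrit : ∑ i, μ i * p i = 1 / 2) : nuVal K μ p = 2 + 4 * ∑ i, μ i * rvec K μ p i := by
  rw [nuVal, sum_vecMul_diagonal_mul,
    sum_success_mulVec hμ.1 ((rvec_eq_iff hK hμ hcrit _).1 rfl).2]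

theorem nuVal_pos [DecidableEq ι] (hK : IsStochastic K) (hμ : HasUniqueStationaryDist K μ)
    (hp : ∀ i, p i ∈ Set.Ioo (0 : ℝ) 1) (hcrit : ∑ i, μ i * p i = 1 / 2) :
    0 < nuVal K μ p := by
  obtain ⟨h1, h2⟩ := (rvec_eq_iff hK hμ hcrit (rvec K μ p)).1 rfl
  rw [nuVal_eq hK hμ hcrit]
  set r := rvec K μ p
  -- twice the stationary variance of the martingale increments
  have hvar : ∑ i, μ i * ∑ j, K i j * (1 + 2 * (2 * p i - 1) * (r j - r i) + (r j - r i) ^ 2) =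
      1 + 2 * ∑ i, μ i * r i := by
    have e1 : ∀ i, ∑ j, K i j * (1 + 2 * (2 * p i - 1) * (r j - r i) + (r j - r i) ^ 2) =
        1 + (K *ᵥ fun j => r j ^ 2) i - r i ^ 2 +
          2 * (2 * p i - 1) * (K *ᵥ r) i - 2 * r i * ((K *ᵥ r) i - r i + (2 * p i - 1)) := by
      intro i
      have : ∀ j, K i j * (1 + 2 * (2 * p i - 1) * (r j - r i) + (r j - r i) ^ 2) =
          K i j * (1 - 2 * (2 * p i - 1) * r i + r i ^ 2) + K i j * r j ^ 2
            + K i j * r j * (2 * (2 * p i - 1) - 2 * r i) := fun j => by ring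
      simp only [this, Finset.sum_add_distrib, ← Finset.sum_mul, hK.2, Matrix.mulVec, dotProduct]
      ring
    have e2 : ∀ i, μ i * (1 + (K *ᵥ fun j => r j ^ 2) i - r i ^ 2 +
          2 * (2 * p i - 1) * (K *ᵥ r) i - 2 * r i * ((K *ᵥ r) i - r i + (2 * p i - 1))) =
        μ i + μ i * (K *ᵥ fun j => r j ^ 2) i - μ i * r i ^ 2 +
          2 * (μ i * (p i * (K *ᵥ r) i)) - 2 * (μ i * ((1 - p i) * (K *ᵥ r) i)) := fun i => by
      have : (K *ᵥ r) i - r i + (2 * p i - 1) = 0 := by linarith [h1 i]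
      rw [this]
      ring
    simp only [e1, e2, Finset.sum_add_distrib, Finset.sum_sub_distrib, hμ.1.1.2,
      hμ.1.sum_mul_mulVec, ← Finset.mul_sum, h2, sum_success_mulVec hμ.1 h2]
    ring
  have hpos : 0 < ∑ i, μ i * ∑ j, K i j *
      (1 + 2 * (2 * p i - 1) * (r j - r i) + (r j - r i) ^ 2) := by
    have hin : ∀ i, 0 < ∑ j, K i j *
        (1 + 2 * (2 * p i - 1) * (r j - r i) + (r j - r i) ^ 2) := by
      intro i
      calc (0 : ℝ) < 4 * (p i * (1 - p i)) :=
            mul_pos (by norm_num) (mul_pos (hp i).1 (sub_pos.2 (hp i).2))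
        _ = ∑ j, K i j * (4 * (p i * (1 - p i))) := by rw [← Finset.sum_mul, hK.2, one_mul]
        _ ≤ _ := Finset.sum_le_sum fun j _ => mul_le_mul_of_nonneg_left
          (by nlinarith [sq_nonneg (r j - r i + (2 * p i - 1))]) (hK.1 i j)
    obtain ⟨k, hk⟩ : ∃ k, μ k ≠ 0 := by
      by_contra! h
      have := hμ.1.1.2
      simp [h] at this
    exact Finset.sum_pos' (fun i _ => mul_nonneg (hμ.1.1.1 i) (hin i).le)
      ⟨k, Finset.mem_univ k, mul_pos (lt_of_le_of_ne (hμ.1.1.1 k) hk.symm) (hin k)⟩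
  linarith

/-- The parameters of the environment and of its reflection satisfy `δ + δ̃ = 1 - 2 / ν`. -/
theorem deltaVal_add_deltaVal_reflected [DecidableEq ι] (hK : IsStochastic K)
    (hμ : HasUniqueStationaryDist K μ) (hp : ∀ i, p i ∈ Set.Ioo (0 : ℝ) 1)
    (hcrit : ∑ i, μ i * p i = 1 / 2) {η : ι → ℝ} (hη : IsProbVec η) :
    deltaVal K μ p η + deltaVal K μ (fun i => 1 - p i) η = 1 - 2 / nuVal K μ p := by
  have hcrit' := sum_one_sub_of_crit hμ.1 hcrit
  have hνpos := nuVal_pos hK hμ hp hcrit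
  obtain ⟨h1, h2⟩ := (rvec_eq_iff hK hμ hcrit (rvec K μ p)).1 rfl
  have h3 := sum_success_mulVec hμ.1 h2
  have hν := nuVal_eq hK hμ hcrit
  have hν' := nuVal_eq hK hμ hcrit'
  have hneg : ∀ (v : ι → ℝ) i, (K *ᵥ fun j => - v j) i = - (K *ᵥ v) i := fun v i =>
    congrFun (Matrix.mulVec_neg v K) i
  have hr' : rvec K μ (fun i => 1 - p i) =
      fun i => - rvec K μ p i + 2 * ∑ a, μ a * rvec K μ p a := by
    refine (rvec_eq_iff hK hμ hcrit' _).2 ⟨fun i => ?_, ?_⟩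
    · rw [mulVec_add_const hK, hneg]
      linarith [h1 i]
    · simp only [mulVec_add_const hK, hneg, sub_sub_cancel, mul_add, ← mul_assoc,
        Finset.sum_add_distrib, ← Finset.sum_mul, hcrit, mul_neg, Finset.sum_neg_distrib]
      simp only [mul_assoc] at h3 ⊢
      rw [h3]
      ring
  have hη2 := hη.2
  have hμ2 := hμ.1.1.2
  rw [hr'] at hν'
  simp only [deltaVal, hr']
  simp only [mul_add, mul_neg, Finset.sum_add_distrib, Finset.sum_neg_distrib, ← Finset.sum_mul,
    hη2, hμ2] at hν' ⊢
  have hνν : nuVal K μ (fun i => 1 - p i) = nuVal K μ p := by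
    rw [hν, hν']; ring
  rw [hνν, ← add_div, eq_sub_iff_add_eq, ← add_div, div_eq_one_iff_eq hνpos.ne', hν]
  ring

end CriticalParameters

section FailureCounts

variable {ι : Type*} [Fintype ι] {K : Matrix ι ι ℝ} {μ p : ι → ℝ}

/-- Probability, starting from a cookie chain in state `i`, of exactly `f` failures before the
`m`-th success. -/
def hitWeight (K : Matrix ι ι ℝ) (p : ι → ℝ) : ℕ → ℕ → ι → ℝ
  | 0, 0 => fun _ => 1
  | 0, _ + 1 => fun _ => 0
  | m + 1, 0 => fun i => p i * (K *ᵥ hitWeight K p m 0) i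
  | m + 1, f + 1 => fun i =>
      p i * (K *ᵥ hitWeight K p m (f + 1)) i + (1 - p i) * (K *ᵥ hitWeight K p (m + 1) f) i
termination_by m f => (m, f)

theorem hitWeight_zero_zero (i : ι) : hitWeight K p 0 0 i = 1 := by rw [hitWeight]

theorem hitWeight_zero_succ (f : ℕ) (i : ι) : hitWeight K p 0 (f + 1) i = 0 := by rw [hitWeight]

theorem hitWeight_succ_zero (m : ℕ) (i : ι) :
    hitWeight K p (m + 1) 0 i = p i * (K *ᵥ hitWeight K p m 0) i := by rw [hitWeight]

theorem hitWeight_succ_succ (m f : ℕ) (i : ι) :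
    hitWeight K p (m + 1) (f + 1) i = p i * (K *ᵥ hitWeight K p m (f + 1)) i +
      (1 - p i) * (K *ᵥ hitWeight K p (m + 1) f) i := by rw [hitWeight]

theorem hitWeight_nonneg (hK : IsStochastic K) (hp : ∀ i, p i ∈ Set.Ioo (0 : ℝ) 1) (m f : ℕ)
    (i : ι) : 0 ≤ hitWeight K p m f i := by
  induction m generalizing f i with
  | zero =>
    cases f
    · simp [hitWeight_zero_zero]
    · simp [hitWeight_zero_succ]
  | succ m ihm =>
    induction f generalizing i with
    | zero =>
      rw [hitWeight_succ_zero]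
      exact mul_nonneg (hp i).1.le (hK.le_mulVec (ihm 0) i)
    | succ f ihf =>
      rw [hitWeight_succ_succ]
      exact add_nonneg (mul_nonneg (hp i).1.le (hK.le_mulVec (ihm _) i))
        (mul_nonneg (sub_nonneg.2 (hp i).2.le) (hK.le_mulVec ihf i))

theorem IsStochastic.mulVec_pos (hK : IsStochastic K) {v : ι → ℝ} (hv : ∀ i, 0 < v i) (i : ι) :
    0 < (K *ᵥ v) i := by
  obtain ⟨k, -, hk⟩ := Finset.exists_min_image Finset.univ v ⟨i, Finset.mem_univ i⟩
  exact (hv k).trans_le (hK.le_mulVec (fun j => hk j (Finset.mem_univ j)) i)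

theorem hitWeight_succ_pos (hK : IsStochastic K) (hp : ∀ i, p i ∈ Set.Ioo (0 : ℝ) 1) (m f : ℕ)
    (i : ι) : 0 < hitWeight K p (m + 1) f i := by
  have hzero : ∀ m i, 0 < hitWeight K p m 0 i := by
    intro m
    induction m with
    | zero => simp [hitWeight_zero_zero]
    | succ m ih =>
      intro i
      rw [hitWeight_succ_zero]
      exact mul_pos (hp i).1 (hK.mulVec_pos ih i)
  induction f generalizing i with
  | zero => exact hzero _ i
  | succ f ih =>
    rw [hitWeight_succ_succ]
    exact add_pos_of_nonneg_of_pos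
      (mul_nonneg (hp i).1.le (hK.le_mulVec (hitWeight_nonneg hK hp _ _) i))
      (mul_pos (sub_pos.2 (hp i).2) (hK.mulVec_pos ih i))

theorem exists_pos_le_prob (hp : ∀ i, p i ∈ Set.Ioo (0 : ℝ) 1) :
    ∃ κ : ℝ, 0 < κ ∧ κ < 1 ∧ ∀ i, κ ≤ p i := by
  rcases isEmpty_or_nonempty ι with h | h
  · exact ⟨1 / 2, by norm_num, by norm_num, fun i => h.elim i⟩
  · obtain ⟨k, -, hk⟩ := Finset.exists_min_image Finset.univ p Finset.univ_nonempty
    exact ⟨p k, (hp k).1, (hp k).2, fun i => hk i (Finset.mem_univ i)⟩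

theorem exists_hitWeight_le_geometric (hK : IsStochastic K) (hp : ∀ i, p i ∈ Set.Ioo (0 : ℝ) 1) :
    ∃ ρ : ℝ, 0 < ρ ∧ ρ < 1 ∧ ∀ m, ∃ C, ∀ f i, hitWeight K p m f i ≤ C * ρ ^ f := by
  obtain ⟨κ, h0, h1, hκ⟩ := exists_pos_le_prob hp
  refine ⟨1 - κ / 2, by linarith, by linarith, fun m => ?_⟩
  set ρ := 1 - κ / 2 with hρ
  have hρ0 : 0 < ρ := by linarith
  suffices h : ∃ C, 0 ≤ C ∧ ∀ f i, hitWeight K p m f i ≤ C * ρ ^ f from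
    h.imp fun _ h => h.2
  induction m with
  | zero =>
    refine ⟨1, zero_le_one, fun f i => ?_⟩
    cases f
    · simp [hitWeight_zero_zero]
    · rw [hitWeight_zero_succ]; positivity
  | succ m ih =>
    obtain ⟨C, hC0, hC⟩ := ih
    have hC' : C ≤ C * (2 / κ) := le_mul_of_one_le_right hC0 (by rw [le_div_iff₀ h0]; linarith)
    refine ⟨C * (2 / κ), by positivity, fun f => ?_⟩
    induction f with
    | zero =>
      intro i
      rw [hitWeight_succ_zero]
      have h2 := hK.mulVec_le (hC 0) i
      have h3 := hK.le_mulVec (hitWeight_nonneg hK hp m 0) i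
      have h4 := mul_le_mul_of_nonneg_right (hp i).2.le h3
      simp only [pow_zero, mul_one] at *
      linarith
    | succ f ihf =>
      intro i
      rw [hitWeight_succ_succ]
      have h2 := hK.mulVec_le (hC (f + 1)) i
      have h3 := hK.le_mulVec (hitWeight_nonneg hK hp m (f + 1)) i
      have h4 := hK.mulVec_le ihf i
      have h5 := hK.le_mulVec (hitWeight_nonneg hK hp (m + 1) f) i
      have h6 := mul_le_mul_of_nonneg_right (hp i).2.le h3
      have h7 : (1 - p i) * (K *ᵥ hitWeight K p (m + 1) f) i ≤
          (1 - κ) * (C * (2 / κ) * ρ ^ f) :=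
        mul_le_mul (by linarith [hκ i]) h4 h5 (by linarith)
      have h8 : C * ρ ^ (f + 1) + (1 - κ) * (C * (2 / κ) * ρ ^ f) ≤
          C * (2 / κ) * ρ ^ (f + 1) := by
        have : C * (2 / κ) * ρ ^ (f + 1) - (1 - κ) * (C * (2 / κ) * ρ ^ f) = C * ρ ^ f := by
          rw [pow_succ, hρ]
          field_simp
          ring
        have h9 : C * ρ ^ (f + 1) ≤ C * ρ ^ f :=
          mul_le_mul_of_nonneg_left (pow_le_pow_of_le_one hρ0.le (by linarith) (Nat.le_succ f)) hC0
        linarith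
      linarith

theorem summable_hitWeight_mul_pow (hK : IsStochastic K) (hp : ∀ i, p i ∈ Set.Ioo (0 : ℝ) 1)
    (m k : ℕ) (i : ι) : Summable fun f : ℕ => hitWeight K p m f i * (f : ℝ) ^ k := by
  obtain ⟨ρ, h0, h1, h⟩ := exists_hitWeight_le_geometric hK hp
  obtain ⟨C, hC⟩ := h m
  have hs := (summable_pow_mul_geometric_of_norm_lt_one k
    (r := ρ) (by rwa [Real.norm_eq_abs, abs_of_pos h0])).mul_left C
  refine Summable.of_nonneg_of_le
    (fun f => mul_nonneg (hitWeight_nonneg hK hp m f i) (by positivity)) (fun f => ?_) hs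
  have := mul_le_mul_of_nonneg_right (hC f i) (by positivity : (0 : ℝ) ≤ (f : ℝ) ^ k)
  linarith

theorem summable_hitWeight_mul_quadratic (hK : IsStochastic K)
    (hp : ∀ i, p i ∈ Set.Ioo (0 : ℝ) 1) (m : ℕ) (i : ι) (a b c : ℝ) :
    Summable fun f : ℕ => hitWeight K p m f i * (a * f ^ 2 + b * f + c) := by
  have h2 := (summable_hitWeight_mul_pow hK hp m 2 i).mul_left a
  have h1 := (summable_hitWeight_mul_pow hK hp m 1 i).mul_left b
  have h0 := (summable_hitWeight_mul_pow hK hp m 0 i).mul_left c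
  refine ((h2.add h1).add h0).congr fun f => ?_
  ring

/-- Expectation of `φ` of the number of failures before the `m`-th success. -/
def failMean (K : Matrix ι ι ℝ) (p : ι → ℝ) (m : ℕ) (φ : ℕ → ℝ) (i : ι) : ℝ :=
  ∑' f, hitWeight K p m f i * φ f

theorem failMean_zero (φ : ℕ → ℝ) (i : ι) : failMean K p 0 φ i = φ 0 := by
  rw [failMean, tsum_eq_single 0]
  · simp [hitWeight_zero_zero]
  · intro f hf
    obtain ⟨f, rfl⟩ := Nat.exists_eq_succ_of_ne_zero hf
    simp [hitWeight_zero_succ]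

theorem mulVec_tsum {g : ℕ → ι → ℝ} (hg : ∀ j, Summable fun f => g f j) (i : ι) :
    (K *ᵥ fun j => ∑' f, g f j) i = ∑' f, (K *ᵥ g f) i := by
  simp only [Matrix.mulVec, dotProduct]
  rw [Summable.tsum_finsetSum fun j _ => (hg j).mul_left _]
  simp only [tsum_mul_left]

theorem failMean_succ {m : ℕ} {φ : ℕ → ℝ}
    (h1 : ∀ j, Summable fun f => hitWeight K p m f j * φ f)
    (h2 : ∀ j, Summable fun f => hitWeight K p (m + 1) f j * φ (f + 1)) (i : ι) :
    failMean K p (m + 1) φ i = p i * (K *ᵥ failMean K p m φ) i +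
      (1 - p i) * (K *ᵥ failMean K p (m + 1) fun f => φ (f + 1)) i := by
  have hmul : ∀ (v : ι → ℝ) (a : ℝ) i, (K *ᵥ fun j => v j * a) i = (K *ᵥ v) i * a := by
    intro v a i
    simp only [Matrix.mulVec, dotProduct, Finset.sum_mul, mul_assoc]
  have hs : ∀ {g : ℕ → ι → ℝ}, (∀ j, Summable fun f => g f j) → Summable fun f => (K *ᵥ g f) i := by
    intro g hg
    exact summable_sum fun j _ => (hg j).mul_left _
  have e1 := mulVec_tsum (K := K) h1 i
  have e2 := mulVec_tsum (K := K) h2 i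
  have s1 := hs h1
  have s2 := hs h2
  simp only [hmul] at e1 e2 s1 s2
  have hS : Summable fun f => hitWeight K p (m + 1) f i * φ f := (summable_nat_add_iff 1).1 <| by
    simp only [hitWeight_succ_succ, add_mul]
    refine Summable.add ?_ ?_
    · simpa only [mul_assoc] using ((summable_nat_add_iff 1).2 s1).mul_left (p i)
    · simpa only [mul_assoc] using s2.mul_left (1 - p i)
  unfold failMean
  rw [e1, e2, hS.tsum_eq_zero_add, s1.tsum_eq_zero_add, hitWeight_succ_zero]
  simp only [hitWeight_succ_succ, add_mul, mul_assoc]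
  rw [Summable.tsum_add (((summable_nat_add_iff 1).2 s1).mul_left (p i))
    (s2.mul_left (1 - p i)), tsum_mul_left, tsum_mul_left]
  ring

theorem eq_zero_of_failure_harmonic (hK : IsStochastic K) (hp : ∀ i, p i ∈ Set.Ioo (0 : ℝ) 1)
    {z : ι → ℝ} (hz : ∀ i, z i = (1 - p i) * (K *ᵥ z) i) (i : ι) : z i = 0 := by
  have h1 := nonneg_of_superharmonic hK hp (fun i => (hz i).ge) i
  have h2 := nonneg_of_superharmonic (z := fun i => - z i) hK hp (fun i => ?_) i
  · linarith
  · have := congrFun (Matrix.mulVec_neg z K) i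
    simp only [Pi.neg_def] at this
    rw [this]
    linarith [hz i]

theorem failMean_one (hK : IsStochastic K) (hp : ∀ i, p i ∈ Set.Ioo (0 : ℝ) 1) (m : ℕ) (i : ι) :
    failMean K p m (fun _ => 1) i = 1 := by
  induction m generalizing i with
  | zero => exact failMean_zero _ i
  | succ m ih =>
    have hs : ∀ m j, Summable fun f => hitWeight K p m f j * (1 : ℝ) := fun m j => by
      simpa using summable_hitWeight_mul_pow hK hp m 0 j
    have hz : ∀ i, failMean K p (m + 1) (fun _ => 1) i + -1 =
        (1 - p i) * (K *ᵥ fun j => failMean K p (m + 1) (fun _ => 1) j + -1) i := fun i => by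
      rw [mulVec_add_const hK, failMean_succ (hs m) (hs (m + 1)), funext ih, hK.mulVec_const]
      ring
    linarith [eq_zero_of_failure_harmonic hK hp hz i]

/-- Mean of the centred failure count. -/
def centeredMean (K : Matrix ι ι ℝ) (p : ι → ℝ) (m : ℕ) : ι → ℝ :=
  failMean K p m fun f => f - m

/-- Second moment of the centred failure count. -/
def centeredSq (K : Matrix ι ι ℝ) (p : ι → ℝ) (m : ℕ) : ι → ℝ :=
  failMean K p m fun f => (f - m) ^ 2

theorem failMean_quadratic (hK : IsStochastic K) (hp : ∀ i, p i ∈ Set.Ioo (0 : ℝ) 1) (m : ℕ)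
    (a b c : ℝ) (i : ι) :
    failMean K p m (fun f => a * ((f : ℝ) - m) ^ 2 + b * (f - m) + c) i =
      a * centeredSq K p m i + b * centeredMean K p m i + c := by
  have h2 : Summable fun f : ℕ => hitWeight K p m f i * ((f : ℝ) - m) ^ 2 :=
    (summable_hitWeight_mul_quadratic hK hp m i 1 (-2 * m) (m ^ 2)).congr fun f => by ring
  have h1 : Summable fun f : ℕ => hitWeight K p m f i * ((f : ℝ) - m) :=
    (summable_hitWeight_mul_quadratic hK hp m i 0 1 (-m)).congr fun f => by ring
  have h0 : Summable fun f : ℕ => hitWeight K p m f i * 1 :=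
    (summable_hitWeight_mul_quadratic hK hp m i 0 0 1).congr fun f => by ring
  have e0 := failMean_one hK hp m i
  unfold centeredSq centeredMean
  unfold failMean at *
  have e1 : ∑' f, hitWeight K p m f i * 1 = 1 := e0
  have e2 : ∀ f : ℕ, hitWeight K p m f i * (a * ((f : ℝ) - m) ^ 2 + b * (f - m) + c) =
      a * (hitWeight K p m f i * ((f : ℝ) - m) ^ 2) + b * (hitWeight K p m f i * ((f : ℝ) - m)) +
        c * (hitWeight K p m f i * 1) := fun f => by ring
  rw [tsum_congr e2, ((h2.mul_left a).add (h1.mul_left b)).tsum_add (h0.mul_left c),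
    (h2.mul_left a).tsum_add (h1.mul_left b), tsum_mul_left, tsum_mul_left, tsum_mul_left, e1,
    mul_one]

theorem mulVec_linear (hK : IsStochastic K) (u v : ι → ℝ) (a b c : ℝ) (i : ι) :
    (K *ᵥ fun j => a * u j + b * v j + c) i = a * (K *ᵥ u) i + b * (K *ᵥ v) i + c := by
  rw [mulVec_add_const hK fun j => a * u j + b * v j]
  simp only [Matrix.mulVec, dotProduct, Finset.mul_sum, mul_add, Finset.sum_add_distrib]
  congr 2 <;> exact Finset.sum_congr rfl fun _ _ => by ring

theorem failMean_quadratic_succ (hK : IsStochastic K) (hp : ∀ i, p i ∈ Set.Ioo (0 : ℝ) 1) (m : ℕ)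
    (a b : ℝ) (i : ι) :
    a * centeredSq K p (m + 1) i + b * centeredMean K p (m + 1) i =
      p i * (a * (K *ᵥ centeredSq K p m) i + (b - 2 * a) * (K *ᵥ centeredMean K p m) i + (a - b)) +
      (1 - p i) * (a * (K *ᵥ centeredSq K p (m + 1)) i +
        (b + 2 * a) * (K *ᵥ centeredMean K p (m + 1)) i + (a + b)) := by
  have h := failMean_succ (K := K) (p := p) (m := m)
    (φ := fun f : ℕ => a * ((f : ℝ) - (m + 1 : ℕ)) ^ 2 + b * (f - (m + 1 : ℕ)) + 0)
    (fun j => (summable_hitWeight_mul_quadratic hK hp m j a (b - 2 * a * (m + 1))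
      (a * (m + 1) ^ 2 - b * (m + 1))).congr fun f => by push_cast; ring)
    (fun j => (summable_hitWeight_mul_quadratic hK hp (m + 1) j a (b - 2 * a * m)
      (a * m ^ 2 - b * m)).congr fun f => by push_cast; ring) i
  rw [failMean_quadratic hK hp] at h
  have e1 : failMean K p m
      (fun f : ℕ => a * ((f : ℝ) - (m + 1 : ℕ)) ^ 2 + b * (f - (m + 1 : ℕ)) + 0) =
      fun j => a * centeredSq K p m j + (b - 2 * a) * centeredMean K p m j + (a - b) := by
    ext j
    rw [← failMean_quadratic hK hp]
    congr 1
    ext f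
    push_cast
    ring
  have e2 : failMean K p (m + 1)
      (fun f : ℕ => a * (((f + 1 : ℕ) : ℝ) - (m + 1 : ℕ)) ^ 2 +
        b * ((f + 1 : ℕ) - (m + 1 : ℕ)) + 0) =
      fun j => a * centeredSq K p (m + 1) j + (b + 2 * a) * centeredMean K p (m + 1) j + (a + b) := by
    ext j
    rw [← failMean_quadratic hK hp]
    congr 1
    ext f
    push_cast
    ring
  rw [e1, e2, mulVec_linear hK, mulVec_linear hK] at h
  linarith

theorem exists_centeredMean_approx [DecidableEq ι] (hK : IsStochastic K)
    (hμ : HasUniqueStationaryDist K μ) (hp : ∀ i, p i ∈ Set.Ioo (0 : ℝ) 1)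
    (hcrit : ∑ i, μ i * p i = 1 / 2) :
    ∃ ρ D : ℝ, 0 < ρ ∧ ρ < 1 ∧ 0 ≤ D ∧ ∀ m i,
      |centeredMean K p m i - (2 * ∑ a, μ a * rvec K μ p a - rvec K μ p i)| ≤ D * ρ ^ m := by
  obtain ⟨ρ, h0, h1, hflat⟩ := exists_geometric_flattening hK hμ hp
  obtain ⟨hr1, hr2⟩ := (rvec_eq_iff hK hμ hcrit (rvec K μ p)).1 rfl
  have hr3 := sum_success_mulVec hμ.1 hr2
  set r := rvec K μ p
  let e : ℕ → ι → ℝ := fun m j => 1 * centeredMean K p m j + 1 * r j + 0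
  have he : ∀ m i, e (m + 1) i = p i * (K *ᵥ e m) i + (1 - p i) * (K *ᵥ e (m + 1)) i := by
    intro m i
    have := failMean_quadratic_succ hK hp m 0 1 i
    simp only [e, mulVec_linear hK]
    linarith [hr1 i]
  obtain ⟨D, hD⟩ := hflat e he
  have hconst : ∀ m, ∑ i, μ i * (p i * (K *ᵥ e m) i) = ∑ i, μ i * r i := by
    intro m
    induction m with
    | zero =>
      rw [← hr3]
      congr! with i _ j
      simp [e, centeredMean, failMean_zero]
    | succ m ih =>
      rw [← ih]
      have h2 := hμ.1.sum_mul_mulVec (e (m + 1))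
      have h3 : ∑ i, μ i * e (m + 1) i = ∑ i, μ i * (p i * (K *ᵥ e m) i) +
          ∑ i, μ i * ((1 - p i) * (K *ᵥ e (m + 1)) i) := by
        rw [← Finset.sum_add_distrib]
        exact Finset.sum_congr rfl fun i _ => by rw [he m i]; ring
      have h4 : ∑ i, μ i * (K *ᵥ e (m + 1)) i = ∑ i, μ i * (p i * (K *ᵥ e (m + 1)) i) +
          ∑ i, μ i * ((1 - p i) * (K *ᵥ e (m + 1)) i) := by
        rw [← Finset.sum_add_distrib]
        exact Finset.sum_congr rfl fun i _ => by ring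
      linarith
  have hmain : ∀ m i, |centeredMean K p m i - (2 * ∑ a, μ a * r a - r i)| ≤ D * ρ ^ m := by
    intro m i
    obtain ⟨lo, hi, hd, hb⟩ := hD m
    have hμp : ∀ a, 0 ≤ μ a * p a := fun a => mul_nonneg (hμ.1.1.1 a) (hp a).1.le
    have h2 : 1 / 2 * lo ≤ ∑ i, μ i * r i := by
      rw [← hconst m, ← hcrit, Finset.sum_mul]
      exact Finset.sum_le_sum fun a _ => by
        rw [← mul_assoc]
        exact mul_le_mul_of_nonneg_left (hK.le_mulVec (fun j => (hb j).1) a) (hμp a)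
    have h3 : ∑ i, μ i * r i ≤ 1 / 2 * hi := by
      rw [← hconst m, ← hcrit, Finset.sum_mul]
      exact Finset.sum_le_sum fun a _ => by
        rw [← mul_assoc]
        exact mul_le_mul_of_nonneg_left (hK.mulVec_le (fun j => (hb j).2) a) (hμp a)
    obtain ⟨h4, h5⟩ := hb i
    simp only [e] at h4 h5
    rw [abs_le]
    constructor <;> linarith
  refine ⟨ρ, |D|, h0, h1, abs_nonneg D, fun m i => (hmain m i).trans ?_⟩
  exact mul_le_mul_of_nonneg_right (le_abs_self D) (by positivity)

theorem exists_centeredSq_approx [DecidableEq ι] (hK : IsStochastic K)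
    (hμ : HasUniqueStationaryDist K μ) (hp : ∀ i, p i ∈ Set.Ioo (0 : ℝ) 1)
    (hcrit : ∑ i, μ i * p i = 1 / 2) :
    ∃ C : ℝ, ∀ m i, |centeredSq K p m i - nuVal K μ p * m| ≤ C := by
  obtain ⟨ρ, D, h0, h1, hD0, hD⟩ := exists_centeredMean_approx hK hμ hp hcrit
  obtain ⟨κ, hκ0, -, hκ⟩ := exists_pos_le_prob hp
  have hν := nuVal_eq hK hμ hcrit
  obtain ⟨hr1, hr2⟩ := (rvec_eq_iff hK hμ hcrit (rvec K μ p)).1 rfl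
  have hr3 := sum_success_mulVec hμ.1 hr2
  have hhalf := sum_one_sub_of_crit hμ.1 hcrit
  set r := rvec K μ p
  set ν := nuVal K μ p
  set c := 2 * ∑ a, μ a * r a with hc
  let G : ι → ℝ := fun i => 1 - 2 * p i * (c - (K *ᵥ r) i) + 2 * (1 - p i) * (c - (K *ᵥ r) i)
  have hG : ∑ i, μ i * (G i - ν * p i) = 0 := by
    have : ∀ i, μ i * (G i - ν * p i) = μ i - 2 * c * (μ i * p i) + 2 * (μ i * (p i * (K *ᵥ r) i))
        + 2 * c * (μ i * (1 - p i)) - 2 * (μ i * ((1 - p i) * (K *ᵥ r) i)) - ν * (μ i * p i) := by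
      intro i
      simp only [G]
      ring
    rw [Finset.sum_congr rfl fun i _ => this i]
    simp only [Finset.sum_add_distrib, Finset.sum_sub_distrib, ← Finset.mul_sum, hcrit, hhalf,
      hr2, hr3, hμ.1.1.2]
    rw [hν]
    ring
  obtain ⟨h, hh⟩ := exists_poisson hK hμ hcrit hG
  let x : ℕ → ι → ℝ := fun m j => 1 * centeredSq K p m j + (-1) * h j + (-(ν * m))
  have hdev : ∀ m i, |(K *ᵥ centeredMean K p m) i - (c - (K *ᵥ r) i)| ≤ D * ρ ^ m := by
    intro m i
    have := hK.abs_mulVec_le (v := fun j => 1 * centeredMean K p m j + 1 * r j + (-c))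
      (c := D * ρ ^ m) (fun j => by
        have := hD m j
        rwa [show 1 * centeredMean K p m j + 1 * r j + -c = centeredMean K p m j - (c - r j)
          by ring]) i
    rw [mulVec_linear hK] at this
    rwa [show (K *ᵥ centeredMean K p m) i - (c - (K *ᵥ r) i) =
      1 * (K *ᵥ centeredMean K p m) i + 1 * (K *ᵥ r) i + -c by ring]
  have hx : ∀ m i, |x (m + 1) i - (p i * (K *ᵥ x m) i + (1 - p i) * (K *ᵥ x (m + 1)) i)| ≤
      2 * D * ρ ^ m := by
    intro m i
    have e1 := failMean_quadratic_succ hK hp m 1 0 i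
    have e2 : x (m + 1) i - (p i * (K *ᵥ x m) i + (1 - p i) * (K *ᵥ x (m + 1)) i) =
        -(2 * p i * ((K *ᵥ centeredMean K p m) i - (c - (K *ᵥ r) i))) +
        2 * (1 - p i) * ((K *ᵥ centeredMean K p (m + 1)) i - (c - (K *ᵥ r) i)) := by
      simp only [x, mulVec_linear hK]
      have := hh i
      simp only [G] at this
      push_cast
      linarith
    rw [e2]
    have d1 := hdev m i
    have d2 := (hdev (m + 1) i).trans (mul_le_mul_of_nonneg_left
      (pow_le_pow_of_le_one h0.le h1.le (Nat.le_succ m)) hD0)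
    have p0 := (hp i).1
    have p1 := (hp i).2
    have a1 := abs_le.1 d1
    have a2 := abs_le.1 d2
    rw [abs_le]
    constructor <;> nlinarith
  obtain ⟨A, hA⟩ : ∃ A, ∀ i, |x 0 i| ≤ A := by
    obtain ⟨A, hA⟩ := (Set.finite_range fun i => |x 0 i|).bddAbove
    exact ⟨A, fun i => hA ⟨i, rfl⟩⟩
  set B := 2 * D / κ / (1 - ρ) with hB
  have hB0 : 0 ≤ B := div_nonneg (by positivity) (by linarith)
  have hBρ : B * (1 - ρ) * κ = 2 * D := by
    have : 1 - ρ ≠ 0 := by linarith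
    rw [hB]
    field_simp
  have hbound : ∀ m i, |x m i| ≤ A + B - B * ρ ^ m := by
    intro m
    induction m with
    | zero => intro i; simpa using hA i
    | succ m ih =>
      intro i
      obtain ⟨k, -, hk⟩ := Finset.exists_max_image Finset.univ (fun i => |x (m + 1) i|)
        ⟨i, Finset.mem_univ i⟩
      refine (hk i (Finset.mem_univ i)).trans ?_
      have b1 := abs_le.1 (hx m k)
      have b2 := abs_le.1 (hK.abs_mulVec_le ih k)
      have b3 := abs_le.1 (hK.abs_mulVec_le (fun j => hk j (Finset.mem_univ j)) k)
      have p0 := (hp k).1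
      have p1 := sub_pos.2 (hp k).2
      have b4 : |x (m + 1) k| ≤ p k * (A + B - B * ρ ^ m) + (1 - p k) * |x (m + 1) k| +
          2 * D * ρ ^ m := by
        have m1 := mul_le_mul_of_nonneg_left b2.1 p0.le
        have m2 := mul_le_mul_of_nonneg_left b2.2 p0.le
        have m3 := mul_le_mul_of_nonneg_left b3.1 p1.le
        have m4 := mul_le_mul_of_nonneg_left b3.2 p1.le
        exact abs_le.2 ⟨by linarith, by linarith⟩
      have b5 : 2 * D * ρ ^ m ≤ p k * (B * (1 - ρ) * ρ ^ m) := by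
        have : κ * (B * (1 - ρ) * ρ ^ m) ≤ p k * (B * (1 - ρ) * ρ ^ m) :=
          mul_le_mul_of_nonneg_right (hκ k)
            (mul_nonneg (mul_nonneg hB0 (by linarith)) (by positivity))
        have e : κ * (B * (1 - ρ) * ρ ^ m) = 2 * D * ρ ^ m := by rw [← hBρ]; ring
        linarith
      have b6 : p k * |x (m + 1) k| ≤ p k * (A + B - B * ρ ^ (m + 1)) := by
        rw [pow_succ]
        linarith
      exact le_of_mul_le_mul_left b6 p0
  obtain ⟨H, hH⟩ : ∃ H, ∀ i, |h i| ≤ H := by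
    obtain ⟨H, hH⟩ := (Set.finite_range fun i => |h i|).bddAbove
    exact ⟨H, fun i => hH ⟨i, rfl⟩⟩
  refine ⟨A + B + H, fun m i => ?_⟩
  have a1 := abs_le.1 (hbound m i)
  have a2 := abs_le.1 (hH i)
  have a3 : 0 ≤ B * ρ ^ m := by positivity
  simp only [x] at a1
  rw [abs_le]
  constructor <;> linarith

end FailureCounts

section BranchingKernel

variable {ι : Type*} [Fintype ι] {K : Matrix ι ι ℝ} {μ p η : ι → ℝ}

/-- Probability that a site entered `i + 1` times from the left sends `j` steps to the left before
its `(i + 1)`-st step to the right. -/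
def branchMass (K : Matrix ι ι ℝ) (p η : ι → ℝ) (i j : ℕ) : ℝ :=
  ∑ a, η a * hitWeight K p (i + 1) j a

/-- The transition kernel of the branching-like process of left crossings. -/
def branchKernel (K : Matrix ι ι ℝ) (p η : ι → ℝ) (i j : ℕ) : ENNReal :=
  ENNReal.ofReal (branchMass K p η i j)

theorem branchMass_nonneg (hK : IsStochastic K) (hp : ∀ i, p i ∈ Set.Ioo (0 : ℝ) 1)
    (hη : IsProbVec η) (i j : ℕ) : 0 ≤ branchMass K p η i j :=
  Finset.sum_nonneg fun a _ => mul_nonneg (hη.1 a) (hitWeight_nonneg hK hp _ _ _)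

theorem branchKernel_ne_zero (hK : IsStochastic K) (hp : ∀ i, p i ∈ Set.Ioo (0 : ℝ) 1)
    (hη : IsProbVec η) (i j : ℕ) : branchKernel K p η i j ≠ 0 := by
  obtain ⟨a, -, ha⟩ : ∃ a ∈ Finset.univ, 0 < η a := by
    by_contra! h
    have := Finset.sum_nonpos h
    linarith [hη.2]
  rw [branchKernel, ne_eq, ENNReal.ofReal_eq_zero, not_le]
  exact Finset.sum_pos' (fun a _ => mul_nonneg (hη.1 a) (hitWeight_nonneg hK hp _ _ _))
    ⟨a, Finset.mem_univ a, mul_pos ha (hitWeight_succ_pos hK hp _ _ _)⟩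

theorem hasSum_branchMass_quadratic (hK : IsStochastic K) (hp : ∀ i, p i ∈ Set.Ioo (0 : ℝ) 1)
    (hη : IsProbVec η) (i : ℕ) (a b c : ℝ) :
    HasSum (fun j : ℕ => branchMass K p η i j * (a * j ^ 2 + b * j + c))
      (a * (∑ s, η s * centeredSq K p (i + 1) s) +
        (b + 2 * a * (i + 1)) * (∑ s, η s * centeredMean K p (i + 1) s) +
        (a * (i + 1) ^ 2 + b * (i + 1) + c)) := by
  have h1 : ∀ s, HasSum (fun j : ℕ => hitWeight K p (i + 1) j s * (a * j ^ 2 + b * j + c))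
      (a * centeredSq K p (i + 1) s + (b + 2 * a * (i + 1)) * centeredMean K p (i + 1) s +
        (a * (i + 1) ^ 2 + b * (i + 1) + c)) := by
    intro s
    rw [← failMean_quadratic hK hp, failMean]
    convert (summable_hitWeight_mul_quadratic hK hp (i + 1) s a b c).hasSum using 3 with j
    push_cast
    ring
  have h2 := hasSum_sum (s := Finset.univ) fun s _ => (h1 s).mul_left (η s)
  have h3 : ∀ s, η s * (a * centeredSq K p (i + 1) s +
      (b + 2 * a * (i + 1)) * centeredMean K p (i + 1) s + (a * (i + 1) ^ 2 + b * (i + 1) + c)) =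
      a * (η s * centeredSq K p (i + 1) s) +
      (b + 2 * a * (i + 1)) * (η s * centeredMean K p (i + 1) s) +
      (a * (i + 1) ^ 2 + b * (i + 1) + c) * η s := fun s => by ring
  rw [Finset.sum_congr rfl fun s _ => h3 s] at h2
  simp only [Finset.sum_add_distrib, ← Finset.mul_sum, hη.2, mul_one] at h2
  refine h2.congr_fun fun j => ?_
  rw [branchMass, Finset.sum_mul]
  exact Finset.sum_congr rfl fun _ _ => by ring

theorem tsum_branchKernel (hK : IsStochastic K) (hp : ∀ i, p i ∈ Set.Ioo (0 : ℝ) 1)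
    (hη : IsProbVec η) (i : ℕ) : ∑' j, branchKernel K p η i j = 1 := by
  have h := hasSum_branchMass_quadratic hK hp hη i 0 0 1
  simp only [zero_mul, zero_add, mul_one, mul_zero] at h
  unfold branchKernel
  rw [← ENNReal.ofReal_tsum_of_nonneg (branchMass_nonneg hK hp hη i) h.summable, h.tsum_eq,
    ENNReal.ofReal_one]

theorem abs_sum_mul_sub_le (hη : IsProbVec η) {v : ι → ℝ} {C : ℝ} {w : ι → ℝ}
    (h : ∀ i, |v i - w i| ≤ C) : |∑ i, η i * v i - ∑ i, η i * w i| ≤ C := by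
  rw [← Finset.sum_sub_distrib]
  refine (Finset.abs_sum_le_sum_abs _ _).trans ?_
  rw [← one_mul C, ← hη.2, Finset.sum_mul]
  refine Finset.sum_le_sum fun i _ => ?_
  rw [← mul_sub, abs_mul, abs_of_nonneg (hη.1 i)]
  exact mul_le_mul_of_nonneg_left (h i) (hη.1 i)

theorem exists_moment_bounds [DecidableEq ι] (hK : IsStochastic K)
    (hμ : HasUniqueStationaryDist K μ) (hp : ∀ i, p i ∈ Set.Ioo (0 : ℝ) 1) (hη : IsProbVec η)
    (hcrit : ∑ i, μ i * p i = 1 / 2) :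
    ∃ ρ D C : ℝ, 0 < ρ ∧ ρ < 1 ∧ 0 ≤ D ∧ 0 ≤ C ∧ ∀ m : ℕ,
      |∑ s, η s * centeredMean K p m s -
        (nuVal K μ p / 2 - 1 - ∑ s, η s * rvec K μ p s)| ≤ D * ρ ^ m ∧
      |∑ s, η s * centeredSq K p m s - nuVal K μ p * m| ≤ C := by
  obtain ⟨ρ, D, h0, h1, hD0, hD⟩ := exists_centeredMean_approx hK hμ hp hcrit
  obtain ⟨C, hC⟩ := exists_centeredSq_approx hK hμ hp hcrit
  have hν := nuVal_eq hK hμ hcrit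
  refine ⟨ρ, D, |C|, h0, h1, hD0, abs_nonneg C, fun m => ⟨?_, ?_⟩⟩
  · have := abs_sum_mul_sub_le hη (hD m)
    simp only [mul_sub, Finset.sum_sub_distrib, ← Finset.sum_mul, hη.2] at this
    convert this using 3
    rw [hν]
    ring
  · have := abs_sum_mul_sub_le hη (hC m)
    rw [← Finset.sum_mul, hη.2, one_mul] at this
    exact this.trans (le_abs_self C)

theorem exists_pow_mul_le_one {ρ : ℝ} (h0 : 0 < ρ) (h1 : ρ < 1) (A : ℝ) :
    ∃ n₀ : ℕ, ∀ n ≥ n₀, A * ρ ^ n ≤ 1 := by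
  have := ((tendsto_pow_atTop_nhds_zero_of_lt_one h0.le h1).const_mul A).eventually_le_const
    (u := 1) (by simp)
  exact eventually_atTop.1 this

theorem natCast_mul_pow_le {ρ : ℝ} (h0 : 0 < ρ) (h1 : ρ < 1) :
    ∃ B : ℝ, 0 ≤ B ∧ ∀ n : ℕ, (n : ℝ) * ρ ^ n ≤ B := by
  obtain ⟨B, hB⟩ := (tendsto_self_mul_const_pow_of_lt_one h0.le h1).bddAbove_range
  exact ⟨B, le_trans (by simp) (hB ⟨0, rfl⟩), fun n => hB ⟨n, rfl⟩⟩

/-- For `δ > 2` the square is a Lyapunov function with linear drift. -/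
theorem exists_lyapunov [DecidableEq ι] (hK : IsStochastic K)
    (hμ : HasUniqueStationaryDist K μ) (hp : ∀ i, p i ∈ Set.Ioo (0 : ℝ) 1) (hη : IsProbVec η)
    (hcrit : ∑ i, μ i * p i = 1 / 2) (hδ : 2 < deltaVal K μ p η) :
    ∃ ε C : ENNReal, ε ≠ 0 ∧ ε ≠ ⊤ ∧ C ≠ ⊤ ∧ ∀ i : ℕ,
      ∑' j : ℕ, branchKernel K p η i j * (j : ENNReal) ^ 2 + ε * i ≤ (i : ENNReal) ^ 2 + C := by
  obtain ⟨ρ, D, C, h0, h1, hD0, hC0, h⟩ := exists_moment_bounds hK hμ hp hη hcrit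
  obtain ⟨B, hB0, hB⟩ := natCast_mul_pow_le h0 h1
  have hν := nuVal_pos hK hμ hp hcrit
  rw [deltaVal, lt_div_iff₀ hν] at hδ
  set ν := nuVal K μ p
  set e := ∑ i, η i * rvec K μ p i
  refine ⟨ENNReal.ofReal (2 * e - 2 * ν), ENNReal.ofReal (C + 2 * D * B + ν + |ν / 2 - 1 - e| * 2 + 1),
    ?_, ENNReal.ofReal_ne_top, ENNReal.ofReal_ne_top, fun i => ?_⟩
  · rw [ne_eq, ENNReal.ofReal_eq_zero]
    linarith
  have hs := hasSum_branchMass_quadratic hK hp hη i 1 0 0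
  have e1 : ∑' j : ℕ, branchKernel K p η i j * (j : ENNReal) ^ 2 =
      ENNReal.ofReal (∑' j : ℕ, branchMass K p η i j * (1 * j ^ 2 + 0 * j + 0)) := by
    rw [ENNReal.ofReal_tsum_of_nonneg (fun j => mul_nonneg (branchMass_nonneg hK hp hη i j)
      (by simp)) hs.summable]
    refine tsum_congr fun j => ?_
    rw [branchKernel, ENNReal.ofReal_mul (branchMass_nonneg hK hp hη i j)]
    simp [ENNReal.ofReal_pow]
  have hr : (i : ENNReal) = ENNReal.ofReal i := by simp
  obtain ⟨hM, hS⟩ := h (i + 1)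
  have hB' := hB (i + 1)
  set M := ∑ s, η s * centeredMean K p (i + 1) s
  set S := ∑ s, η s * centeredSq K p (i + 1) s
  rw [e1, hs.tsum_eq, hr, ← ENNReal.ofReal_mul (by linarith), ← ENNReal.ofReal_pow (by simp)]
  have hval : 1 * S + (0 + 2 * 1 * ((i : ℝ) + 1)) * M + (1 * ((i : ℝ) + 1) ^ 2 + 0 * (i + 1) + 0) +
      (2 * e - 2 * ν) * i ≤ (i : ℝ) ^ 2 + (C + 2 * D * B + ν + |ν / 2 - 1 - e| * 2 + 1) := by
    have a1 := (abs_le.1 hM).2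
    have a2 := (abs_le.1 hS).2
    have a3 := le_abs_self (ν / 2 - 1 - e)
    have a4 := mul_le_mul_of_nonneg_left hB' hD0
    push_cast at a1 a2 a4
    have a5 := mul_le_mul_of_nonneg_left a1 (by positivity : (0 : ℝ) ≤ 2 * ((i : ℝ) + 1))
    nlinarith
  have hnn : 0 ≤ 1 * S + (0 + 2 * 1 * ((i : ℝ) + 1)) * M +
      (1 * ((i : ℝ) + 1) ^ 2 + 0 * (i + 1) + 0) := by
    rw [← hs.tsum_eq]
    exact tsum_nonneg fun j => mul_nonneg (branchMass_nonneg hK hp hη i j) (by simp)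
  rw [← ENNReal.ofReal_add hnn (mul_nonneg (by linarith) (by simp)),
    ← ENNReal.ofReal_add (by positivity) (by positivity)]
  exact ENNReal.ofReal_le_ofReal hval

/-- For `δ ≤ 2` there is a nontrivial subharmonic function of at most quadratic growth vanishing
at the origin, and the downward drift is bounded. -/
theorem exists_subharmonic [DecidableEq ι] (hK : IsStochastic K)
    (hμ : HasUniqueStationaryDist K μ) (hp : ∀ i, p i ∈ Set.Ioo (0 : ℝ) 1) (hη : IsProbVec η)
    (hcrit : ∑ i, μ i * p i = 1 / 2) (hδ : deltaVal K μ p η ≤ 2) :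
    (∃ φ : ℕ → ENNReal, φ 0 = 0 ∧ (∃ n, φ n ≠ 0) ∧ (∀ n : ℕ, φ n ≤ (n : ENNReal) ^ 2) ∧
      ∀ n, φ n ≤ ∑' j, branchKernel K p η n j * φ j) ∧
    ∃ C : ℕ, ∀ n : ℕ, (n : ENNReal) ≤ ∑' j : ℕ, branchKernel K p η n j * j + C := by
  obtain ⟨ρ, D, C, h0, h1, hD0, hC0, h⟩ := exists_moment_bounds hK hμ hp hη hcrit
  obtain ⟨B, hB0, hB⟩ := natCast_mul_pow_le h0 h1
  have hν := nuVal_pos hK hμ hp hcrit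
  rw [deltaVal, div_le_iff₀ hν] at hδ
  set ν := nuVal K μ p
  set e := ∑ i, η i * rvec K μ p i
  have hbm := branchMass_nonneg hK hp hη
  constructor
  · set a := 2 * (C + 2 * D * B + 2 * |ν / 2 - 1 - e| + 2) / ν with ha
    have ha0 : 0 ≤ a := by positivity
    have haν : a * ν = 2 * (C + 2 * D * B + 2 * |ν / 2 - 1 - e| + 2) := by
      rw [ha]
      field_simp
    obtain ⟨n₁, hn₁⟩ := exists_pow_mul_le_one h0 h1 (a * D)
    obtain ⟨n₂, hn₂⟩ := exists_nat_ge a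
    set b : ℝ := ((n₁ + n₂ : ℕ) : ℝ) ^ 2 with hb
    have hb0 : 0 ≤ b := by positivity
    refine ⟨fun n => ENNReal.ofReal (n ^ 2 - a * n - b), ?_, ?_, fun n => ?_, fun n => ?_⟩
    · simp [hb0]
    · obtain ⟨n, hn⟩ := exists_nat_gt (a + b + 1)
      refine ⟨n, ?_⟩
      rw [ne_eq, ENNReal.ofReal_eq_zero, not_le]
      nlinarith
    · rw [← ENNReal.ofReal_natCast, ← ENNReal.ofReal_pow (by simp)]
      refine ENNReal.ofReal_le_ofReal ?_
      have : 0 ≤ a * n := by positivity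
      linarith
    · simp only
      rcases le_or_gt ((n : ℝ) ^ 2 - a * n - b) 0 with hneg | hpos
      · rw [ENNReal.ofReal_of_nonpos hneg]
        exact zero_le
      have hn : (n₁ + n₂ : ℕ) < n := by
        have h2 : b < (n : ℝ) ^ 2 := by
          have : 0 ≤ a * n := by positivity
          linarith
        exact_mod_cast lt_of_pow_lt_pow_left₀ 2 (by positivity) h2
      have hs := hasSum_branchMass_quadratic hK hp hη n 1 (-a) (-b)
      set g : ℕ → ℝ := fun j => 1 * (j : ℝ) ^ 2 + -a * j + -b with hg
      have hs' : Summable fun j => branchMass K p η n j * max (g j) 0 :=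
        Summable.of_nonneg_of_le (fun j => mul_nonneg (hbm n j) (le_max_right _ _))
          (fun j => by
            rw [abs_mul, abs_of_nonneg (hbm n j)]
            exact mul_le_mul_of_nonneg_left (max_le (le_abs_self _) (abs_nonneg _)) (hbm n j))
          hs.summable.abs
      have e1 : ∑' j : ℕ, branchKernel K p η n j * ENNReal.ofReal (j ^ 2 - a * j - b) =
          ENNReal.ofReal (∑' j : ℕ, branchMass K p η n j * max (g j) 0) := by
        rw [ENNReal.ofReal_tsum_of_nonneg
          (fun j => mul_nonneg (hbm n j) (le_max_right _ _)) hs']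
        refine tsum_congr fun j => ?_
        rw [branchKernel, ENNReal.ofReal_mul (hbm n j), ENNReal.ofReal_max, ENNReal.ofReal_zero,
          max_eq_left zero_le]
        congr 2
        simp only [hg]
        ring
      rw [e1]
      refine ENNReal.ofReal_le_ofReal (le_trans ?_ (hs.summable.tsum_le_tsum
        (fun j => mul_le_mul_of_nonneg_left (le_max_left _ _) (hbm n j)) hs'))
      rw [hs.tsum_eq]
      obtain ⟨hM, hS⟩ := h (n + 1)
      have hB' := hB (n + 1)
      have hρ := hn₁ (n + 1) (by omega)
      set M := ∑ s, η s * centeredMean K p (n + 1) s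
      set S := ∑ s, η s * centeredSq K p (n + 1) s
      have hna : a ≤ n := hn₂.trans (by exact_mod_cast (by omega : n₂ ≤ n))
      have a1 := (abs_le.1 hM).1
      have a1' := (abs_le.1 hM).2
      have a2 := (abs_le.1 hS).1
      have a3 := neg_abs_le (ν / 2 - 1 - e)
      have a4 := mul_le_mul_of_nonneg_left hB' hD0
      push_cast at a1 a1' a2 a4
      have a5 := mul_le_mul_of_nonneg_left a1 (by positivity : (0 : ℝ) ≤ 2 * ((n : ℝ) + 1))
      have a6 := mul_le_mul_of_nonneg_left a1' ha0
      have a7 : 0 ≤ (2 * ν - 2 * e) * (n - a / 2) := mul_nonneg (by linarith) (by linarith)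
      nlinarith
  · obtain ⟨c, hc⟩ := exists_nat_ge (D + |ν / 2 - 1 - e|)
    refine ⟨c, fun n => ?_⟩
    have hs := hasSum_branchMass_quadratic hK hp hη n 0 1 0
    have e1 : ∑' j : ℕ, branchKernel K p η n j * (j : ENNReal) =
        ENNReal.ofReal (∑' j : ℕ, branchMass K p η n j * (0 * j ^ 2 + 1 * j + 0)) := by
      rw [ENNReal.ofReal_tsum_of_nonneg (fun j => mul_nonneg (hbm n j) (by simp)) hs.summable]
      refine tsum_congr fun j => ?_
      rw [branchKernel, ENNReal.ofReal_mul (hbm n j)]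
      simp
    rw [e1, hs.tsum_eq, ← ENNReal.ofReal_natCast n, ← ENNReal.ofReal_natCast c,
      ← ENNReal.ofReal_add _ (by positivity)]
    · refine ENNReal.ofReal_le_ofReal ?_
      have a1 := (abs_le.1 (h (n + 1)).1).1
      have a3 := neg_abs_le (ν / 2 - 1 - e)
      have a4 : D * ρ ^ (n + 1) ≤ D := mul_le_of_le_one_right hD0 (pow_le_one₀ h0.le h1.le)
      linarith
    · rw [← hs.tsum_eq]
      exact tsum_nonneg fun j => mul_nonneg (hbm n j) (by simp)

end BranchingKernel

section CountableChain

variable {P : ℕ → ℕ → ENNReal}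

/-- Law at time `s` of the chain with kernel `P` started at `0`. -/
def chainLaw (P : ℕ → ℕ → ENNReal) : ℕ → ℕ → ENNReal
  | 0 => fun j => if j = 0 then 1 else 0
  | s + 1 => fun j => ∑' i, chainLaw P s i * P i j

theorem tsum_chainLaw_zero (g : ℕ → ENNReal) : ∑' j, chainLaw P 0 j * g j = g 0 := by
  rw [tsum_eq_single 0 fun j hj => by simp [chainLaw, hj]]
  simp [chainLaw]

theorem tsum_chainLaw_succ (s : ℕ) (g : ℕ → ENNReal) :
    ∑' j, chainLaw P (s + 1) j * g j = ∑' i, chainLaw P s i * ∑' j, P i j * g j := by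
  simp only [chainLaw, ← ENNReal.tsum_mul_right, ← ENNReal.tsum_mul_left]
  rw [ENNReal.tsum_comm]
  simp only [mul_assoc]

theorem tsum_chainLaw (h1 : ∀ i, ∑' j, P i j = 1) (s : ℕ) : ∑' j, chainLaw P s j = 1 := by
  induction s with
  | zero => simpa using tsum_chainLaw_zero (P := P) fun _ => 1
  | succ s ih => simpa [h1, ih] using tsum_chainLaw_succ (P := P) s fun _ => 1

theorem sum_mean_le_of_lyapunov (h1 : ∀ i, ∑' j, P i j = 1) {ε C : ENNReal}
    (h : ∀ i : ℕ, ∑' j : ℕ, P i j * (j : ENNReal) ^ 2 + ε * i ≤ (i : ENNReal) ^ 2 + C) (M : ℕ) :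
    ε * ∑ s ∈ Finset.range M, ∑' j : ℕ, chainLaw P s j * j ≤ C * M := by
  refine le_trans (le_add_of_nonneg_left zero_le :
    _ ≤ ∑' j : ℕ, chainLaw P M j * (j : ENNReal) ^ 2 + _) ?_
  induction M with
  | zero => simp [tsum_chainLaw_zero]
  | succ M ih =>
    have h2 : ∑' i : ℕ, chainLaw P M i * (∑' j : ℕ, P i j * (j : ENNReal) ^ 2 + ε * i) ≤
        ∑' i : ℕ, chainLaw P M i * ((i : ENNReal) ^ 2 + C) :=
      ENNReal.tsum_le_tsum fun i => mul_le_mul_right (h i) _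
    have h3 : ∑' i : ℕ, chainLaw P M i * (ε * i) = ε * ∑' i : ℕ, chainLaw P M i * i := by
      rw [← ENNReal.tsum_mul_left]
      exact tsum_congr fun i => by ring
    simp only [mul_add, ENNReal.tsum_add, ENNReal.tsum_mul_right, tsum_chainLaw h1, one_mul,
      h3] at h2
    rw [tsum_chainLaw_succ, Finset.sum_range_succ, mul_add, Nat.cast_succ, mul_add, mul_one]
    calc _ = (∑' i, chainLaw P M i * ∑' j : ℕ, P i j * (j : ENNReal) ^ 2 +
            ε * ∑' i : ℕ, chainLaw P M i * i) +
          ε * ∑ s ∈ Finset.range M, ∑' j : ℕ, chainLaw P s j * j := by ring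
      _ ≤ (∑' i : ℕ, chainLaw P M i * (i : ENNReal) ^ 2 + C) +
          ε * ∑ s ∈ Finset.range M, ∑' j : ℕ, chainLaw P s j * j := by gcongr
      _ = (∑' i : ℕ, chainLaw P M i * (i : ENNReal) ^ 2 +
          ε * ∑ s ∈ Finset.range M, ∑' j : ℕ, chainLaw P s j * j) + C := by ring
      _ ≤ _ := by gcongr

/-- The kernel `P` killed at the origin, acting on functions. -/
def killedOp (P : ℕ → ℕ → ENNReal) (g : ℕ → ENNReal) (i : ℕ) : ENNReal :=
  ∑' j, P i (j + 1) * g (j + 1)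

theorem killedOp_mono {g h : ℕ → ENNReal} (hgh : ∀ n, g n ≤ h n) (n : ℕ) :
    killedOp P g n ≤ killedOp P h n :=
  ENNReal.tsum_le_tsum fun j => mul_le_mul_right (hgh (j + 1)) _

theorem killedOp_tsum (g : ℕ → ℕ → ENNReal) (n : ℕ) :
    killedOp P (fun j => ∑' t, g t j) n = ∑' t, killedOp P (g t) n := by
  simp only [killedOp, ← ENNReal.tsum_mul_left]
  exact ENNReal.tsum_comm

theorem killedOp_add_const_le (h1 : ∀ i, ∑' j, P i j = 1) (g : ℕ → ENNReal) (c : ENNReal) (n : ℕ) :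
    killedOp P (fun j => g j + c) n ≤ killedOp P g n + c := by
  simp only [killedOp, mul_add, ENNReal.tsum_add, ENNReal.tsum_mul_right]
  gcongr
  refine mul_le_of_le_one_left zero_le ?_
  rw [← h1 n, tsum_eq_zero_add' ENNReal.summable (f := fun j => P n j)]
  exact le_add_of_nonneg_left zero_le

theorem tsum_eq_killedOp {g : ℕ → ENNReal} (h0 : g 0 = 0) (n : ℕ) :
    ∑' j, P n j * g j = killedOp P g n := by
  rw [tsum_eq_zero_add' ENNReal.summable, h0, mul_zero, zero_add, killedOp]

theorem le_iterate_killedOp {φ : ℕ → ENNReal} (hφ : ∀ n, φ n ≤ killedOp P φ n) (t n : ℕ) :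
    φ n ≤ (killedOp P)^[t] φ n := by
  induction t generalizing n with
  | zero => simp
  | succ t ih =>
    rw [Function.iterate_succ_apply']
    exact (hφ n).trans (killedOp_mono ih n)

theorem natCast_le_iterate_killedOp (h1 : ∀ i, ∑' j, P i j = 1) {c : ℕ}
    (hc : ∀ n : ℕ, (n : ENNReal) ≤ killedOp P (fun j => (j : ENNReal)) n + c) (t n : ℕ) :
    (n : ENNReal) ≤ (killedOp P)^[t] (fun j => (j : ENNReal)) n + c * t := by
  induction t generalizing n with
  | zero => simp
  | succ t ih =>
    rw [Function.iterate_succ_apply', Nat.cast_succ, mul_add, mul_one, ← add_assoc]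
    exact (hc n).trans (add_le_add_left
      ((killedOp_mono ih n).trans (killedOp_add_const_le h1 _ _ n)) _)

/-- Expected sum of the chain until it is killed at the origin. -/
def excursionArea (P : ℕ → ℕ → ENNReal) (n : ℕ) : ENNReal :=
  ∑' t, (killedOp P)^[t] (fun j => (j : ENNReal)) n

theorem sq_le_excursionArea (h1 : ∀ i, ∑' j, P i j = 1) {c : ℕ}
    (hc : ∀ n : ℕ, (n : ENNReal) ≤ killedOp P (fun j => (j : ENNReal)) n + c) (n : ℕ) :
    (n : ENNReal) ^ 2 ≤ (4 * (c + 1) : ℕ) * excursionArea P n := by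
  set T := n / (2 * (c + 1)) + 1 with hT
  have hTn : n ≤ 2 * (c + 1) * T := (Nat.lt_mul_div_succ n (by positivity)).le
  have h2 : ∀ t ∈ Finset.range T,
      (n : ENNReal) ≤ 2 * (killedOp P)^[t] (fun j => (j : ENNReal)) n := by
    intro t ht
    have ht' : 2 * (c * t) ≤ n := by
      have h3 : t ≤ n / (2 * (c + 1)) := by simpa [hT, Nat.lt_succ_iff] using ht
      have h4 := (Nat.le_div_iff_mul_le (by positivity)).1 h3
      nlinarith
    have h5 : (2 * (c * t) : ENNReal) ≤ n := by exact_mod_cast ht'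
    have h6 := natCast_le_iterate_killedOp h1 hc t n
    have h7 : (n : ENNReal) + n ≤ 2 * (killedOp P)^[t] (fun j => (j : ENNReal)) n + n := by
      calc (n : ENNReal) + n = 2 * n := by ring
        _ ≤ 2 * ((killedOp P)^[t] (fun j => (j : ENNReal)) n + c * t) := by gcongr
        _ = 2 * (killedOp P)^[t] (fun j => (j : ENNReal)) n + 2 * (c * t) := by ring
        _ ≤ _ := by gcongr
    exact (ENNReal.add_le_add_iff_right (ENNReal.natCast_ne_top n)).1 h7
  have h3 : (T : ENNReal) * n ≤ 2 * excursionArea P n := by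
    calc (T : ENNReal) * n = ∑ _t ∈ Finset.range T, (n : ENNReal) := by simp
      _ ≤ ∑ t ∈ Finset.range T, 2 * (killedOp P)^[t] (fun j => (j : ENNReal)) n :=
          Finset.sum_le_sum h2
      _ = 2 * ∑ t ∈ Finset.range T, (killedOp P)^[t] (fun j => (j : ENNReal)) n :=
          (Finset.mul_sum _ _ _).symm
      _ ≤ _ := by
          gcongr
          exact ENNReal.sum_le_tsum _
  calc (n : ENNReal) ^ 2 = n * n := sq _
    _ ≤ ((2 * (c + 1) * T : ℕ) : ENNReal) * n := by gcongr
    _ = 2 * (c + 1) * (T * n) := by push_cast; ring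
    _ ≤ 2 * (c + 1) * (2 * excursionArea P n) := by gcongr
    _ = _ := by push_cast; ring

theorem exists_le_chainLaw_zero (h1 : ∀ i, ∑' j, P i j = 1) (hpos : ∀ i j, P i j ≠ 0)
    {C : ENNReal} (hC : C ≠ ⊤) (h : ∀ s, ∑' j : ℕ, chainLaw P s j * j ≤ C) :
    ∃ c : ENNReal, c ≠ 0 ∧ ∀ s, c ≤ 2 * chainLaw P s 0 := by
  obtain ⟨L, hL⟩ := ENNReal.exists_nat_gt (ENNReal.mul_ne_top (by norm_num : (2 : ENNReal) ≠ ⊤) hC)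
  obtain ⟨k, -, hk⟩ := Finset.exists_min_image (Finset.range (L + 1)) (fun i => P i 0) ⟨0, by simp⟩
  have hL0 : (L : ENNReal) ≠ 0 := (zero_le.trans_lt hL).ne'
  refine ⟨P k 0, hpos k 0, fun s => ?_⟩
  cases s with
  | zero =>
    have : P k 0 ≤ 1 := h1 k ▸ ENNReal.le_tsum 0
    exact this.trans (by norm_num [chainLaw])
  | succ s =>
    set A := ∑ i ∈ Finset.range (L + 1), chainLaw P s i with hA
    have h2 : (L : ENNReal) ≤ L * A + C := by
      calc (L : ENNReal) = ∑' i, (L : ENNReal) * chainLaw P s i := by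
            rw [ENNReal.tsum_mul_left, tsum_chainLaw h1, mul_one]
        _ ≤ ∑' i : ℕ, ((if i ∈ Finset.range (L + 1) then L * chainLaw P s i else 0) +
              chainLaw P s i * i) := by
            refine ENNReal.tsum_le_tsum fun i => ?_
            split_ifs with hi
            · exact le_add_of_nonneg_right zero_le
            · rw [zero_add, mul_comm]
              have : L ≤ i := by
                rw [Finset.mem_range] at hi
                omega
              gcongr
        _ ≤ L * A + C := by
            rw [ENNReal.tsum_add, hA, Finset.mul_sum]
            refine add_le_add (le_of_eq ?_) (h s)
            rw [tsum_eq_sum (s := Finset.range (L + 1)) fun i hi => if_neg hi]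
            exact Finset.sum_congr rfl fun i hi => if_pos hi
    have h3 : (L : ENNReal) + L ≤ L * (2 * A) + L := by
      calc (L : ENNReal) + L = 2 * L := by ring
        _ ≤ 2 * (L * A + C) := by gcongr
        _ = L * (2 * A) + 2 * C := by ring
        _ ≤ _ := by gcongr
    have h4 : (L : ENNReal) * 1 ≤ L * (2 * A) := by
      rw [mul_one]
      exact (ENNReal.add_le_add_iff_right (ENNReal.natCast_ne_top L)).1 h3
    have h5 : 1 ≤ 2 * A := (ENNReal.mul_le_mul_iff_right hL0 (ENNReal.natCast_ne_top L)).1 h4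
    calc P k 0 ≤ P k 0 * (2 * A) := le_mul_of_one_le_right zero_le h5
      _ = 2 * ∑ i ∈ Finset.range (L + 1), chainLaw P s i * P k 0 := by
          rw [← Finset.sum_mul]
          ring
      _ ≤ 2 * ∑ i ∈ Finset.range (L + 1), chainLaw P s i * P i 0 := by
          gcongr with i hi
          exact hk i hi
      _ ≤ _ := by
          gcongr
          exact ENNReal.sum_le_tsum _

theorem sum_iterate_killedOp_le {c : ENNReal} (hc : ∀ s, c ≤ 2 * chainLaw P s 0) (s : ℕ)
    (g : ℕ → ENNReal) :
    c * ∑ t ∈ Finset.range s, (killedOp P)^[t + 1] g 0 ≤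
      2 * ∑' j, chainLaw P s (j + 1) * g (j + 1) := by
  induction s generalizing g with
  | zero => simp
  | succ s ih =>
    have h1 : ∑' j, chainLaw P (s + 1) (j + 1) * g (j + 1) =
        chainLaw P s 0 * killedOp P g 0 + ∑' i, chainLaw P s (i + 1) * killedOp P g (i + 1) := by
      rw [← tsum_eq_zero_add' (f := fun i => chainLaw P s i * killedOp P g i) ENNReal.summable]
      simp only [chainLaw, killedOp, ← ENNReal.tsum_mul_right, ← ENNReal.tsum_mul_left]
      rw [ENNReal.tsum_comm]
      simp only [mul_assoc]
    rw [h1, Finset.sum_range_succ', mul_add, mul_add, add_comm, ← mul_assoc 2]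
    refine add_le_add ?_ (ih (killedOp P g))
    simp only [zero_add, Function.iterate_one]
    gcongr
    exact hc s

/-- A chain whose drift admits a subharmonic function of quadratic growth does not have bounded
mean. -/
theorem not_bounded_mean_of_subharmonic (h1 : ∀ i, ∑' j, P i j = 1) (hpos : ∀ i j, P i j ≠ 0)
    {φ : ℕ → ENNReal} (hφ0 : φ 0 = 0) (hφ : ∃ n, φ n ≠ 0) (hφsq : ∀ n : ℕ, φ n ≤ (n : ENNReal) ^ 2)
    (hsub : ∀ n, φ n ≤ ∑' j, P n j * φ j) {c : ℕ}
    (hc : ∀ n : ℕ, (n : ENNReal) ≤ ∑' j : ℕ, P n j * j + c) {C : ENNReal} (hC : C ≠ ⊤) :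
    ¬ ∀ s, ∑' j : ℕ, chainLaw P s j * j ≤ C := by
  intro h
  have hc' : ∀ n : ℕ, (n : ENNReal) ≤ killedOp P (fun j => (j : ENNReal)) n + c := by
    intro n
    have := tsum_eq_killedOp (P := P) (g := fun j : ℕ => (j : ENNReal)) (by simp) n
    rw [← this]
    exact hc n
  have hφ' : ∀ n, φ n ≤ killedOp P φ n := fun n => tsum_eq_killedOp (P := P) hφ0 n ▸ hsub n
  obtain ⟨q, hq0, hq⟩ := exists_le_chainLaw_zero h1 hpos hC h
  have hsucc : q * ∑' t, (killedOp P)^[t + 1] (fun j => (j : ENNReal)) 0 ≤ 2 * C := by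
    rw [ENNReal.tsum_eq_iSup_nat, ENNReal.mul_iSup]
    refine iSup_le fun s => (sum_iterate_killedOp_le hq s _).trans ?_
    gcongr
    refine le_trans ?_ (h s)
    rw [tsum_eq_zero_add' (f := fun j : ℕ => chainLaw P s j * j) ENNReal.summable]
    exact le_add_of_nonneg_left zero_le
  have hkill : ∀ s n, (killedOp P)^[s] (excursionArea P) n =
      ∑' t, (killedOp P)^[t + s] (fun j => (j : ENNReal)) n := by
    intro s
    induction s with
    | zero => intro n; rfl
    | succ s ih =>
      intro n
      rw [Function.iterate_succ_apply', funext ih, killedOp_tsum]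
      simp only [← Function.iterate_succ_apply' (killedOp P)]
      rfl
  obtain ⟨m, hm⟩ := hφ
  obtain ⟨m, rfl⟩ := Nat.exists_eq_succ_of_ne_zero (n := m) (by rintro rfl; exact hm hφ0)
  have hfin : excursionArea P (m + 1) ≠ ⊤ := by
    intro htop
    have h2 : killedOp P (excursionArea P) 0 = ⊤ := by
      refine top_unique ?_
      rw [← ENNReal.mul_top (hpos 0 (m + 1)), ← htop]
      exact ENNReal.le_tsum (f := fun j => P 0 (j + 1) * excursionArea P (j + 1)) m
    have h3 := hkill 1 0
    rw [Function.iterate_one] at h3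
    rw [← h3, h2, ENNReal.mul_top hq0] at hsucc
    exact ENNReal.mul_ne_top (by norm_num) hC (top_unique hsucc)
  have hlim := ENNReal.Tendsto.const_mul (a := (4 * (c + 1) : ℕ))
    (ENNReal.tendsto_sum_nat_add _ hfin) (Or.inr (ENNReal.natCast_ne_top _))
  rw [mul_zero] at hlim
  refine hm (le_antisymm (ge_of_tendsto' hlim fun s => ?_) zero_le)
  rw [← hkill s, ← nsmul_eq_mul]
  have hmul : ∀ s n, (killedOp P)^[s] (fun j => (4 * (c + 1)) • excursionArea P j) n =
      (4 * (c + 1)) • (killedOp P)^[s] (excursionArea P) n := by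
    intro s
    induction s with
    | zero => intro n; rfl
    | succ s ih =>
      intro n
      rw [Function.iterate_succ_apply', Function.iterate_succ_apply', funext ih]
      simp only [killedOp, nsmul_eq_mul, ← ENNReal.tsum_mul_left]
      exact tsum_congr fun j => by ring
  rw [← hmul]
  refine (le_iterate_killedOp hφ' s _).trans ?_
  have hmono : ∀ s n, (killedOp P)^[s] φ n ≤
      (killedOp P)^[s] (fun j => (4 * (c + 1)) • excursionArea P j) n := by
    intro s
    induction s with
    | zero =>
      intro n
      refine (hφsq n).trans ((sq_le_excursionArea h1 hc' n).trans ?_)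
      simp
    | succ s ih =>
      intro n
      rw [Function.iterate_succ_apply', Function.iterate_succ_apply']
      exact killedOp_mono ih n
  exact hmono s _

end CountableChain

section FailureEvent

/-- Number of successes among the first `n` tosses. -/
def successes (b : ℕ → Bool) (n : ℕ) : ℕ := Nat.count (fun j => b j = true) n

theorem successes_zero (b : ℕ → Bool) : successes b 0 = 0 := Nat.count_zero _

theorem successes_succ (b : ℕ → Bool) (n : ℕ) :
    successes b (n + 1) = successes b n + if b n = true then 1 else 0 := Nat.count_succ _ _

theorem successes_succ' (b : ℕ → Bool) (n : ℕ) :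
    successes b (n + 1) = successes (fun j => b (j + 1)) n + if b 0 = true then 1 else 0 :=
  Nat.count_succ' _ _

theorem successes_le (b : ℕ → Bool) (n : ℕ) : successes b n ≤ n := Nat.count_le _

theorem successes_add_le (b : ℕ → Bool) (n d : ℕ) :
    successes b (n + d) ≤ successes b n + d := by
  rw [successes, Nat.count_add]
  exact Nat.add_le_add_left (Nat.count_le _) _

theorem successes_mono (b : ℕ → Bool) : Monotone (successes b) := Nat.count_monotone _

/-- The `m`-th success in the sequence `b` is preceded by exactly `f` failures, and (for `m > 0`)
it is the toss with index `m + f - 1`. -/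
def HitEvent (m f : ℕ) (b : ℕ → Bool) : Prop :=
  successes b (m + f) = m ∧ ∀ j < m + f, successes b j < m

theorem hitEvent_zero_iff {f : ℕ} {b : ℕ → Bool} : HitEvent 0 f b ↔ f = 0 := by
  constructor
  · rintro ⟨-, h⟩
    by_contra hf
    exact absurd (h 0 (by omega)) (by simp [successes_zero])
  · rintro rfl
    exact ⟨by simp [successes_zero], by simp⟩

theorem hitEvent_succ_iff_of_true {m f : ℕ} {b : ℕ → Bool} (hb : b 0 = true) :
    HitEvent (m + 1) f b ↔ HitEvent m f fun j => b (j + 1) := by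
  unfold HitEvent
  rw [show m + 1 + f = m + f + 1 by omega, successes_succ', if_pos hb]
  refine and_congr (by omega) ⟨fun h j hj => ?_, fun h j hj => ?_⟩
  · have := h (j + 1) (by omega)
    rw [successes_succ', if_pos hb] at this
    omega
  · cases j with
    | zero => simp [successes_zero]
    | succ j =>
      have := h j (by omega)
      rw [successes_succ', if_pos hb]
      omega

theorem hitEvent_succ_succ_iff_of_false {m f : ℕ} {b : ℕ → Bool} (hb : b 0 = false) :
    HitEvent (m + 1) (f + 1) b ↔ HitEvent (m + 1) f fun j => b (j + 1) := by
  have hb' : ¬ b 0 = true := by simp [hb]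
  unfold HitEvent
  rw [show m + 1 + (f + 1) = m + 1 + f + 1 by omega, successes_succ', if_neg hb']
  refine and_congr (by omega) ⟨fun h j hj => ?_, fun h j hj => ?_⟩
  · have := h (j + 1) (by omega)
    rw [successes_succ', if_neg hb'] at this
    omega
  · cases j with
    | zero => simp [successes_zero]
    | succ j =>
      have := h j (by omega)
      rw [successes_succ', if_neg hb']
      omega

theorem not_hitEvent_succ_zero_of_false {m : ℕ} {b : ℕ → Bool} (hb : b 0 = false) :
    ¬ HitEvent (m + 1) 0 b := by
  rintro ⟨h, -⟩
  rw [add_zero, successes_succ', if_neg (by simp [hb])] at h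
  have := successes_le (fun j => b (j + 1)) m
  omega

theorem hitEvent_congr {m f : ℕ} {b b' : ℕ → Bool} (h : ∀ j < m + f, b j = b' j) :
    HitEvent m f b ↔ HitEvent m f b' := by
  have hc : ∀ n ≤ m + f, successes b n = successes b' n := by
    intro n hn
    induction n with
    | zero => rw [successes_zero, successes_zero]
    | succ n ih => rw [successes_succ, successes_succ, ih (by omega), h n (by omega)]
  unfold HitEvent
  rw [hc _ le_rfl]
  refine and_congr Iff.rfl (forall₂_congr fun j hj => ?_)
  rw [hc j hj.le]

theorem HitEvent.mono {m m' f f' : ℕ} {b : ℕ → Bool} (hm : m ≤ m') (h : HitEvent m f b)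
    (h' : HitEvent m' f' b) : f ≤ f' := by
  have h1 : m + f ≤ m' + f' := by
    by_contra! hlt
    have := h.2 _ hlt
    rw [h'.1] at this
    omega
  obtain ⟨d, hd⟩ := Nat.exists_eq_add_of_le h1
  have h2 := successes_add_le b (m + f) d
  rw [← hd, h.1, h'.1] at h2
  omega

theorem HitEvent.unique {m f f' : ℕ} {b : ℕ → Bool} (h : HitEvent m f b)
    (h' : HitEvent m f' b) : f = f' :=
  le_antisymm (h.mono le_rfl h') (h'.mono le_rfl h)

end FailureEvent

section CylinderWeight

/-- Extension of the tosses in a finite string by failures. -/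
def tosses {α : Type*} {L : ℕ} (q : Fin L → α × Bool) (j : ℕ) : Bool :=
  if h : j < L then (q ⟨j, h⟩).2 else false

theorem tosses_cons_zero {α : Type*} {L : ℕ} (a : α × Bool) (q : Fin L → α × Bool) :
    tosses (Fin.cons (α := fun _ => α × Bool) a q) 0 = a.2 := by
  simp [tosses]

theorem tosses_cons_succ {α : Type*} {L : ℕ} (a : α × Bool) (q : Fin L → α × Bool) :
    (fun j => tosses (Fin.cons (α := fun _ => α × Bool) a q) (j + 1)) = tosses q := by
  ext j
  simp only [tosses, Nat.add_lt_add_iff_right]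
  split_ifs with h
  · rw [show (⟨j + 1, by omega⟩ : Fin (L + 1)) = Fin.succ ⟨j, h⟩ from rfl, Fin.cons_succ]
  · rfl

variable {ι : Type*} {K : Matrix ι ι ℝ} {p : ι → ℝ}

/-- Weight of a finite string of (state, toss) pairs for the cookie chain with initial vector
`start`. -/
def cylWeight (K : Matrix ι ι ℝ) (p : ι → ℝ) (start : ι → ℝ) :
    (L : ℕ) → (Fin L → ι × Bool) → ℝ
  | 0, _ => 1
  | L + 1, q => start (q 0).1 * (if (q 0).2 then p (q 0).1 else 1 - p (q 0).1) *
      cylWeight K p (K (q 0).1) L (Fin.tail q)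

theorem prod_eq_cylWeight (start : ι → ℝ) (M : ℕ) (f : ℕ → ι) (b : ℕ → Bool) :
    start (f 0) * (∏ j ∈ Finset.range M, K (f j) (f (j + 1))) *
      ∏ j ∈ Finset.range (M + 1), (if b j then p (f j) else 1 - p (f j)) =
    cylWeight K p start (M + 1) fun j => (f j, b j) := by
  induction M generalizing start f b with
  | zero => simp [cylWeight]
  | succ M ih =>
    rw [cylWeight, Finset.prod_range_succ', Finset.prod_range_succ' _ (M + 1)]
    have := ih (K (f 0)) (fun j => f (j + 1)) (fun j => b (j + 1))
    have e : Fin.tail (fun j : Fin (M + 1 + 1) => (f j, b j)) =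
        fun j : Fin (M + 1) => (f (j + 1), b (j + 1)) := by
      ext j <;> simp [Fin.tail]
    rw [e]
    simp only [Fin.val_zero]
    rw [← this]
    by_cases h : b 0 = true <;> simp only [h, if_true] <;> ring

theorem sum_fin_succ_eq {α : Type*} [Fintype α] {L : ℕ} (F : (Fin (L + 1) → α) → ℝ) :
    ∑ q, F q = ∑ a, ∑ q, F (Fin.cons a q) := by
  rw [← Fintype.sum_prod_type', ← (Fin.consEquiv fun _ => α).sum_comp]
  rfl

variable [Fintype ι]

theorem sum_cylWeight_cons (start : ι → ℝ) (L : ℕ) (A : (Fin (L + 1) → ι × Bool) → Prop) :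
    ∑ q, (if A q then cylWeight K p start (L + 1) q else 0) =
      ∑ a, start a *
        (p a * ∑ q, (if A (Fin.cons (a, true) q) then cylWeight K p (K a) L q else 0) +
        (1 - p a) * ∑ q, (if A (Fin.cons (a, false) q) then cylWeight K p (K a) L q else 0)) := by
  rw [sum_fin_succ_eq, Fintype.sum_prod_type]
  refine Finset.sum_congr rfl fun a _ => ?_
  simp only [cylWeight, Fintype.sum_bool, Fin.cons_zero, Fin.tail_cons, if_true,
    Bool.false_eq_true, if_false, mul_add, Finset.mul_sum, mul_ite, mul_zero, mul_assoc]

theorem sum_cylWeight (hK : IsStochastic K) {start : ι → ℝ} (hs : ∑ a, start a = 1) (L : ℕ) :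
    ∑ q, cylWeight K p start L q = 1 := by
  induction L generalizing start with
  | zero => simp [cylWeight]
  | succ L ih =>
    have := sum_cylWeight_cons (K := K) (p := p) start L fun _ => True
    simp only [if_true, fun a => ih (hK.2 a)] at this
    rw [this]
    conv_rhs => rw [← hs]
    exact Finset.sum_congr rfl fun a _ => by ring

theorem sum_cylWeight_hitEvent (hK : IsStochastic K) {start : ι → ℝ} (hs : ∑ a, start a = 1)
    {L m f : ℕ} (hL : m + f ≤ L) :
    ∑ q, (if HitEvent m f (tosses q) then cylWeight K p start L q else 0) =
      ∑ a, start a * hitWeight K p m f a := by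
  induction L generalizing start m f with
  | zero =>
    obtain ⟨rfl, rfl⟩ : m = 0 ∧ f = 0 := by omega
    simp [hitEvent_zero_iff, cylWeight, hitWeight_zero_zero, hs]
  | succ L ih =>
    rcases m with _ | m
    · rcases f with _ | f
      · simp [hitEvent_zero_iff, hitWeight_zero_zero, hs, sum_cylWeight hK hs]
      · simp [hitEvent_zero_iff, hitWeight_zero_succ]
    rw [sum_cylWeight_cons]
    refine Finset.sum_congr rfl fun a _ => ?_
    congr 1
    simp only [hitEvent_succ_iff_of_true (tosses_cons_zero (a, true) _), tosses_cons_succ]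
    rw [ih (hK.2 a) (by omega)]
    rcases f with _ | f
    · simp only [not_hitEvent_succ_zero_of_false (tosses_cons_zero (a, false) _), if_false,
        Finset.sum_const_zero, mul_zero, add_zero, hitWeight_succ_zero]
      rfl
    · simp only [hitEvent_succ_succ_iff_of_false (tosses_cons_zero (a, false) _), tosses_cons_succ]
      rw [ih (hK.2 a) (by omega), hitWeight_succ_succ]
      rfl

end CylinderWeight

section CookieEnvironment

variable {N : ℕ} {Ω : Type*} [MeasurableSpace Ω] {Pm : Measure Ω}
  {K : Matrix (Fin N) (Fin N) ℝ} {p η : Fin N → ℝ}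
  {Rc : ℤ → ℕ → Ω → Fin N} {ξ : ℤ → ℕ → Ω → Bool}

theorem cylWeight_nonneg {ι : Type*} [Fintype ι] {K : Matrix ι ι ℝ} {p start : ι → ℝ}
    (hK : IsStochastic K) (hp : ∀ i, p i ∈ Set.Ioo (0 : ℝ) 1) (hs : ∀ i, 0 ≤ start i) (L : ℕ)
    (q : Fin L → ι × Bool) : 0 ≤ cylWeight K p start L q := by
  induction L generalizing start with
  | zero => exact zero_le_one
  | succ L ih =>
    refine mul_nonneg (mul_nonneg (hs _) ?_) (ih (hK.1 _) _)
    split_ifs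
    · exact (hp _).1.le
    · exact sub_nonneg.2 (hp _).2.le

theorem IsCookieEnv.measure_box [IsProbabilityMeasure Pm] (henv : IsCookieEnv Pm K p η Rc ξ)
    (hK : IsStochastic K) (hp : ∀ i, p i ∈ Set.Ioo (0 : ℝ) 1) (hη : IsProbVec η)
    (S : Finset ℤ) (M : ℕ) (A : ℤ → (Fin (M + 1) → Fin N × Bool) → Prop) :
    MeasurableSet {ω | ∀ x ∈ S, A x fun j => (Rc x j ω, ξ x j ω)} ∧
    Pm {ω | ∀ x ∈ S, A x fun j => (Rc x j ω, ξ x j ω)} =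
      ENNReal.ofReal (∏ x ∈ S, ∑ q, if A x q then cylWeight K p η (M + 1) q else 0) := by
  obtain ⟨a₀⟩ : Nonempty (Fin N) := by
    by_contra h
    rw [not_nonempty_iff] at h
    simpa using hη.2
  obtain ⟨hR, hξ, hcyl⟩ := henv
  let path : Ω → S → Fin (M + 1) → Fin N × Bool := fun ω x j => (Rc x j ω, ξ x j ω)
  have hpath : Measurable path :=
    measurable_pi_lambda _ fun x => measurable_pi_lambda _ fun j => (hR x j).prodMk (hξ x j)
  let t : S → Finset (Fin (M + 1) → Fin N × Bool) := fun x => Finset.univ.filter (A x)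
  have hset : {ω | ∀ x ∈ S, A x fun j => (Rc x j ω, ξ x j ω)} =
      path ⁻¹' (Fintype.piFinset t : Set (S → Fin (M + 1) → Fin N × Bool)) := by
    ext ω
    simp [path, t]
  rw [hset]
  refine ⟨hpath (Finset.measurableSet _), ?_⟩
  rw [← sum_measure_preimage_singleton _ fun Q _ => hpath (measurableSet_singleton Q)]
  have hsingle : ∀ Q, Pm (path ⁻¹' {Q}) =
      ENNReal.ofReal (∏ x : S, cylWeight K p η (M + 1) (Q x)) := by
    intro Q
    let q : ℤ → ℕ → Fin N × Bool := fun x j =>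
      if hx : x ∈ S then Q ⟨x, hx⟩ (Fin.ofNat (M + 1) j) else (a₀, true)
    have hq : ∀ (x : S), (fun j : Fin (M + 1) => ((q x j).1, (q x j).2)) = Q x := by
      intro x
      ext j <;> simp [q]
    have h := hcyl S M (fun x j => (q x j).1) (fun x j => (q x j).2)
    rw [Finset.prod_congr rfl fun x _ =>
      prod_eq_cylWeight η M (fun j => (q x j).1) fun j => (q x j).2] at h
    have hset' : {ω | ∀ x ∈ S, ∀ j ≤ M, Rc x j ω = (q x j).1 ∧ ξ x j ω = (q x j).2} =
        path ⁻¹' {Q} := by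
      ext ω
      simp only [Set.mem_ofPred_eq, Set.mem_preimage, Set.mem_singleton_iff, funext_iff, path]
      constructor
      · intro hω x j
        have := hω x x.2 j (Nat.lt_succ_iff.1 j.2)
        rw [this.1, this.2]
        exact congrFun (hq x) j
      · intro hω x hx j hj
        have h1 := hω ⟨x, hx⟩ ⟨j, Nat.lt_succ_iff.2 hj⟩
        rw [← congrFun (hq ⟨x, hx⟩)] at h1
        exact Prod.ext_iff.1 h1
    rw [hset'] at h
    rw [← ENNReal.ofReal_toReal (measure_ne_top Pm (path ⁻¹' {Q})), h, ← Finset.prod_coe_sort]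
    congr 1
    exact Finset.prod_congr rfl fun x _ => by rw [← hq x]
  simp only [hsingle]
  rw [← ENNReal.ofReal_sum_of_nonneg fun Q _ =>
    Finset.prod_nonneg fun x _ => cylWeight_nonneg hK hp hη.1 _ _,
    ← Finset.prod_univ_sum t fun _ q => cylWeight K p η (M + 1) q]
  simp only [t, Finset.sum_filter]
  rw [Finset.prod_coe_sort S fun x => ∑ q, if A x q then cylWeight K p η (M + 1) q else 0]

theorem IsCookieEnv.hitEvent_law [IsProbabilityMeasure Pm] (henv : IsCookieEnv Pm K p η Rc ξ)
    (hK : IsStochastic K) (hp : ∀ i, p i ∈ Set.Ioo (0 : ℝ) 1) (hη : IsProbVec η)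
    (S : Finset ℤ) (i f : ℤ → ℕ) :
    MeasurableSet {ω | ∀ x ∈ S, HitEvent (i x + 1) (f x) fun j => ξ x j ω} ∧
    Pm {ω | ∀ x ∈ S, HitEvent (i x + 1) (f x) fun j => ξ x j ω} =
      ∏ x ∈ S, branchKernel K p η (i x) (f x) := by
  set M := ∑ x ∈ S, (i x + 1 + f x) with hM
  have hle : ∀ x ∈ S, i x + 1 + f x ≤ M := fun x hx =>
    Finset.single_le_sum (f := fun x => i x + 1 + f x) (fun _ _ => Nat.zero_le _) hx
  have h := henv.measure_box hK hp hη S M fun x q => HitEvent (i x + 1) (f x) (tosses q)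
  have hset : {ω | ∀ x ∈ S, HitEvent (i x + 1) (f x) fun j => ξ x j ω} =
      {ω | ∀ x ∈ S, HitEvent (i x + 1) (f x)
        (tosses fun j : Fin (M + 1) => (Rc x j ω, ξ x j ω))} := by
    ext ω
    refine forall₂_congr fun x hx => hitEvent_congr fun j hj => ?_
    have : j < M + 1 := by
      have := hle x hx
      omega
    simp [tosses, this]
  rw [hset]
  refine ⟨h.1, h.2.trans ?_⟩
  rw [ENNReal.ofReal_prod_of_nonneg fun x _ => Finset.sum_nonneg fun q _ => by
    split_ifs
    exacts [cylWeight_nonneg hK hp hη.1 _ _, le_rfl]]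
  refine Finset.prod_congr rfl fun x hx => ?_
  rw [sum_cylWeight_hitEvent hK hη.2 ((hle x hx).trans (Nat.le_succ M))]
  rfl

/-- `CrossingEvent ξ n s j`: for the walk stopped when it first enters `n` from the left, the
number of left crossings of the edge `s` steps below `n`, determined by the tosses at the sites
`n - s, …, n - 1`, equals `j`. -/
def CrossingEvent (ξ : ℤ → ℕ → Bool) (n : ℤ) : ℕ → ℕ → Prop
  | 0, j => j = 0
  | s + 1, j => ∃ i, CrossingEvent ξ n s i ∧ HitEvent (i + 1) j (ξ (n - s - 1))

theorem CrossingEvent.unique {ξ : ℤ → ℕ → Bool} {n : ℤ} {s i j : ℕ} (hi : CrossingEvent ξ n s i)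
    (hj : CrossingEvent ξ n s j) : i = j := by
  induction s generalizing i j with
  | zero => exact hi.trans hj.symm
  | succ s ih =>
    obtain ⟨i', h1, h2⟩ := hi
    obtain ⟨j', h3, h4⟩ := hj
    obtain rfl := ih h1 h3
    exact h2.unique h4

theorem CrossingEvent.mono {ξ : ℤ → ℕ → Bool} {n : ℤ} {s i j : ℕ} (hi : CrossingEvent ξ n s i)
    (hj : CrossingEvent ξ (n + 1) (s + 1) j) : i ≤ j := by
  induction s generalizing i j with
  | zero => exact hi.trans_le (Nat.zero_le j)
  | succ s ih =>
    obtain ⟨i', h1, h2⟩ := hi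
    obtain ⟨j', h3, h4⟩ := hj
    rw [show n + 1 - ((s + 1 : ℕ) : ℤ) - 1 = n - s - 1 by push_cast; ring] at h4
    exact h2.mono (Nat.succ_le_succ (ih h1 h3)) h4

theorem IsCookieEnv.crossingEvent_law [IsProbabilityMeasure Pm] (henv : IsCookieEnv Pm K p η Rc ξ)
    (hK : IsStochastic K) (hp : ∀ i, p i ∈ Set.Ioo (0 : ℝ) 1) (hη : IsProbVec η) (n : ℤ)
    (s j : ℕ) (S : Finset ℤ) (hS : ∀ x ∈ S, x < n - s) (i f : ℤ → ℕ) :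
    MeasurableSet {ω | CrossingEvent (fun x j => ξ x j ω) n s j ∧
      ∀ x ∈ S, HitEvent (i x + 1) (f x) fun j => ξ x j ω} ∧
    Pm {ω | CrossingEvent (fun x j => ξ x j ω) n s j ∧
      ∀ x ∈ S, HitEvent (i x + 1) (f x) fun j => ξ x j ω} =
      chainLaw (branchKernel K p η) s j * ∏ x ∈ S, branchKernel K p η (i x) (f x) := by
  induction s generalizing j S i f with
  | zero =>
    by_cases hj : j = 0
    · simpa [CrossingEvent, chainLaw, hj] using henv.hitEvent_law hK hp hη S i f
    · simp [CrossingEvent, chainLaw, hj]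
  | succ s ih =>
    set x₀ : ℤ := n - s - 1 with hx₀
    have hlt : ∀ x ∈ S, x < x₀ := fun x hx => by
      have := hS x hx
      push_cast at this
      omega
    have hnot : x₀ ∉ S := fun h => lt_irrefl _ (hlt _ h)
    have hne : ∀ x ∈ S, x ≠ x₀ := fun x hx => (hlt x hx).ne
    let E : ℕ → Set Ω := fun k => {ω | CrossingEvent (fun x j => ξ x j ω) n s k ∧
      ∀ x ∈ insert x₀ S, HitEvent (Function.update i x₀ k x + 1) (Function.update f x₀ j x)
        fun j => ξ x j ω}
    have hE := fun k => ih k (insert x₀ S) (fun x hx => by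
      rcases Finset.mem_insert.1 hx with rfl | hx
      · omega
      · have := hlt x hx
        omega) (Function.update i x₀ k) (Function.update f x₀ j)
    have hset : {ω | CrossingEvent (fun x j => ξ x j ω) n (s + 1) j ∧
        ∀ x ∈ S, HitEvent (i x + 1) (f x) fun j => ξ x j ω} = ⋃ k, E k := by
      ext ω
      simp only [CrossingEvent, E, Set.mem_iUnion, Set.mem_ofPred_eq, Finset.forall_mem_insert,
        Function.update_self]
      have hcongr : ∀ k, (∀ x ∈ S, HitEvent (Function.update i x₀ k x + 1)
          (Function.update f x₀ j x) fun j => ξ x j ω) ↔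
          ∀ x ∈ S, HitEvent (i x + 1) (f x) fun j => ξ x j ω := fun k =>
        forall₂_congr fun x hx => by
          rw [Function.update_of_ne (hne x hx), Function.update_of_ne (hne x hx)]
      simp only [hcongr, ← and_assoc, exists_and_right]
      exact Iff.rfl
    rw [hset]
    refine ⟨MeasurableSet.iUnion fun k => (hE k).1, ?_⟩
    rw [measure_iUnion (fun k l hkl => Set.disjoint_left.2 fun ω hk hl => hkl (hk.1.unique hl.1))
      fun k => (hE k).1, chainLaw, ← ENNReal.tsum_mul_right]
    refine tsum_congr fun k => ?_
    rw [(hE k).2, Finset.prod_insert hnot, Function.update_self, Function.update_self, mul_assoc]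
    congr 2
    exact Finset.prod_congr rfl fun x hx => by
      rw [Function.update_of_ne (hne x hx), Function.update_of_ne (hne x hx)]

theorem IsCookieEnv.measure_crossingEvent [IsProbabilityMeasure Pm]
    (henv : IsCookieEnv Pm K p η Rc ξ) (hK : IsStochastic K) (hp : ∀ i, p i ∈ Set.Ioo (0 : ℝ) 1)
    (hη : IsProbVec η) (n : ℤ) (s j : ℕ) :
    MeasurableSet {ω | CrossingEvent (fun x j => ξ x j ω) n s j} ∧
    Pm {ω | CrossingEvent (fun x j => ξ x j ω) n s j} = chainLaw (branchKernel K p η) s j := by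
  simpa using henv.crossingEvent_law hK hp hη n s j ∅ (by simp) 0 0

theorem IsCookieEnv.ae_exists_crossingEvent [IsProbabilityMeasure Pm]
    (henv : IsCookieEnv Pm K p η Rc ξ) (hK : IsStochastic K) (hp : ∀ i, p i ∈ Set.Ioo (0 : ℝ) 1)
    (hη : IsProbVec η) :
    ∀ᵐ ω ∂Pm, ∀ (n : ℤ) (s : ℕ), ∃ j, CrossingEvent (fun x j => ξ x j ω) n s j := by
  rw [ae_all_iff]
  intro n
  rw [ae_all_iff]
  intro s
  have h := henv.measure_crossingEvent hK hp hη n s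
  have hset : {ω | ∃ j, CrossingEvent (fun x j => ξ x j ω) n s j} =
      ⋃ j, {ω | CrossingEvent (fun x j => ξ x j ω) n s j} := by
    ext ω
    simp
  have hmeas : MeasurableSet {ω | ∃ j, CrossingEvent (fun x j => ξ x j ω) n s j} :=
    hset ▸ MeasurableSet.iUnion fun j => (h j).1
  rw [ae_iff, ← Set.compl_ofPred, prob_compl_eq_zero_iff hmeas, hset,
    measure_iUnion (fun k l hkl => Set.disjoint_left.2 fun ω hk hl => hkl (hk.unique hl))
      fun k => (h k).1]
  simp only [(h _).2]
  exact tsum_chainLaw (tsum_branchKernel hK hp hη) s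

/-- Value of `φ` at the number of crossings recorded by `CrossingEvent`. -/
def crossingValue (φ : ℕ → ENNReal) (ξ : ℤ → ℕ → Bool) (n : ℤ) (s : ℕ) : ENNReal :=
  ∑' j, if CrossingEvent ξ n s j then φ j else 0

theorem CrossingEvent.value_eq {φ : ℕ → ENNReal} {ξ : ℤ → ℕ → Bool} {n : ℤ} {s j : ℕ}
    (h : CrossingEvent ξ n s j) : crossingValue φ ξ n s = φ j := by
  rw [crossingValue, tsum_eq_single j fun k hk => if_neg fun h' => hk (h'.unique h), if_pos h]

theorem IsCookieEnv.lintegral_crossingValue [IsProbabilityMeasure Pm]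
    (henv : IsCookieEnv Pm K p η Rc ξ) (hK : IsStochastic K) (hp : ∀ i, p i ∈ Set.Ioo (0 : ℝ) 1)
    (hη : IsProbVec η) (φ : ℕ → ENNReal) (n : ℤ) (s : ℕ) :
    Measurable (fun ω => crossingValue φ (fun x j => ξ x j ω) n s) ∧
    ∫⁻ ω, crossingValue φ (fun x j => ξ x j ω) n s ∂Pm =
      ∑' j, chainLaw (branchKernel K p η) s j * φ j := by
  have h := henv.measure_crossingEvent hK hp hη n s
  have hm : ∀ j, Measurable fun ω =>
      if CrossingEvent (fun x j => ξ x j ω) n s j then φ j else 0 := fun j =>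
    Measurable.ite (h j).1 measurable_const measurable_const
  refine ⟨Measurable.tsum hm, ?_⟩
  unfold crossingValue
  rw [lintegral_tsum fun j => (hm j).aemeasurable]
  refine tsum_congr fun j => ?_
  have := lintegral_indicator_const (μ := Pm) (h j).1 (φ j)
  rw [(h j).2] at this
  rw [mul_comm, ← this]
  rfl

/-- The truncated means of the crossing chain increase in time. -/
theorem IsCookieEnv.monotone_truncated_mean [IsProbabilityMeasure Pm]
    (henv : IsCookieEnv Pm K p η Rc ξ) (hK : IsStochastic K) (hp : ∀ i, p i ∈ Set.Ioo (0 : ℝ) 1)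
    (hη : IsProbVec η) {φ : ℕ → ENNReal} (hφ : Monotone φ) :
    Monotone fun s => ∑' j, chainLaw (branchKernel K p η) s j * φ j := by
  refine monotone_nat_of_le_succ fun s => ?_
  rw [← (henv.lintegral_crossingValue hK hp hη φ 0 s).2,
    ← (henv.lintegral_crossingValue hK hp hη φ (0 + 1) (s + 1)).2]
  refine lintegral_mono_ae ?_
  filter_upwards [henv.ae_exists_crossingEvent hK hp hη] with ω hω
  obtain ⟨i, hi⟩ := hω 0 s
  obtain ⟨j, hj⟩ := hω (0 + 1) (s + 1)
  rw [hi.value_eq, hj.value_eq]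
  exact hφ (hi.mono hj)

end CookieEnvironment

section Walk

theorem HitEvent.le_failures {m f D : ℕ} {b : ℕ → Bool} (h : HitEvent m f b)
    (hD : m ≤ successes b D) : successes b D + f ≤ D := by
  have h1 : m + f ≤ D := by
    by_contra! hlt
    exact (h.2 D hlt).not_ge hD
  obtain ⟨d, rfl⟩ := Nat.exists_eq_add_of_le h1
  have h2 := successes_add_le b (m + f) d
  rw [h.1] at h2
  omega

theorem HitEvent.failures_le {m f D : ℕ} {b : ℕ → Bool} (h : HitEvent m f b)
    (hD : successes b D ≤ m)
    (hlast : successes b D = m → D = 0 ∨ ∃ d, D = d + 1 ∧ b d = true) :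
    D ≤ successes b D + f := by
  have h1 : D ≤ m + f := by
    by_contra! hlt
    have h2 := successes_mono b hlt.le
    rw [h.1] at h2
    obtain rfl | ⟨d, rfl, hd⟩ := hlast (le_antisymm hD h2)
    · omega
    · have h3 := successes_mono b (Nat.lt_succ_iff.1 hlt)
      rw [h.1] at h3
      rw [successes_succ, if_pos hd] at hD
      omega
  obtain ⟨d, hd⟩ := Nat.exists_eq_add_of_le h1
  have h2 := successes_add_le b D d
  rw [← hd, h.1] at h2
  omega

variable (ξ : ℤ → ℕ → Bool)

/-- Number of visits of the walk to `x` strictly before time `t`. -/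
def visits (t : ℕ) (x : ℤ) : ℕ := (walkHist ξ t).tail.count x

theorem walkHist_eq_cons (t : ℕ) : walkHist ξ t = walk ξ t :: (walkHist ξ t).tail := by
  cases t <;> rfl

theorem visits_succ (t : ℕ) (x : ℤ) :
    visits ξ (t + 1) x = visits ξ t x + if walk ξ t = x then 1 else 0 := by
  change (walkHist ξ t).count x = _
  rw [walkHist_eq_cons, List.count_cons]
  simp [visits]

theorem walk_succ (t : ℕ) :
    walk ξ (t + 1) = walk ξ t + if ξ (walk ξ t) (visits ξ t (walk ξ t)) = true then 1 else -1 :=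
  rfl

/-- Number of steps to the right from `x` before time `t`. -/
def rightSteps (t : ℕ) (x : ℤ) : ℕ := successes (ξ x) (visits ξ t x)

/-- Number of steps to the left from `x` before time `t`. -/
def leftSteps (t : ℕ) (x : ℤ) : ℕ := visits ξ t x - rightSteps ξ t x

theorem rightSteps_add_leftSteps (t : ℕ) (x : ℤ) :
    rightSteps ξ t x + leftSteps ξ t x = visits ξ t x :=
  Nat.add_sub_of_le (successes_le _ _)

theorem rightSteps_succ (t : ℕ) (x : ℤ) :
    rightSteps ξ (t + 1) x = rightSteps ξ t x +
      if walk ξ t = x ∧ ξ x (visits ξ t x) = true then 1 else 0 := by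
  unfold rightSteps
  rw [visits_succ]
  by_cases h : walk ξ t = x <;> simp [h, successes_succ]

theorem leftSteps_succ (t : ℕ) (x : ℤ) :
    leftSteps ξ (t + 1) x = leftSteps ξ t x +
      if walk ξ t = x ∧ ¬ ξ x (visits ξ t x) = true then 1 else 0 := by
  have h1 := rightSteps_add_leftSteps ξ (t + 1) x
  have h2 := rightSteps_add_leftSteps ξ t x
  rw [rightSteps_succ, visits_succ] at h1
  by_cases h : walk ξ t = x <;> by_cases h' : ξ x (visits ξ t x) = true <;>
    simp [h, h'] at h1 ⊢ <;> omega

/-- Each crossing of an edge to the right is followed by a crossing to the left, up to the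
difference caused by the initial and the current position. -/
theorem rightSteps_add_eq (t : ℕ) (k : ℤ) :
    rightSteps ξ t k + (if k < 0 then 1 else 0) =
      leftSteps ξ t (k + 1) + if k < walk ξ t then 1 else 0 := by
  induction t with
  | zero => simp [rightSteps, leftSteps, visits, walkHist, successes_zero, walk]; rfl
  | succ t ih =>
    rw [rightSteps_succ, leftSteps_succ, walk_succ]
    by_cases h : ξ (walk ξ t) (visits ξ t (walk ξ t)) = true
    · have h1 : (walk ξ t = k ∧ ξ k (visits ξ t k) = true) ↔ walk ξ t = k :=
        ⟨fun h => h.1, fun hk => ⟨hk, hk ▸ h⟩⟩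
      have h2 : ¬ (walk ξ t = k + 1 ∧ ¬ ξ (k + 1) (visits ξ t (k + 1)) = true) :=
        fun h' => h'.2 (h'.1 ▸ h)
      simp only [h1, h2, h, if_true, if_false]
      split_ifs at ih ⊢ <;> omega
    · have h1 : ¬ (walk ξ t = k ∧ ξ k (visits ξ t k) = true) := fun h' => h (h'.1 ▸ h'.2)
      have h2 : (walk ξ t = k + 1 ∧ ¬ ξ (k + 1) (visits ξ t (k + 1)) = true) ↔
          walk ξ t = k + 1 := ⟨fun h => h.1, fun hk => ⟨hk, hk ▸ h⟩⟩
      simp only [h1, h2, if_neg h, if_false]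
      split_ifs at ih ⊢ <;> omega

theorem visits_eq_zero_or_last_step_right {t : ℕ} {k : ℤ} (hk : k < walk ξ t) :
    visits ξ t k = 0 ∨ ∃ d, visits ξ t k = d + 1 ∧ ξ k d = true := by
  induction t with
  | zero => exact Or.inl rfl
  | succ t ih =>
    rw [visits_succ]
    by_cases h : walk ξ t = k
    · rw [if_pos h]
      refine Or.inr ⟨_, rfl, ?_⟩
      by_contra h'
      rw [walk_succ, h, if_neg h'] at hk
      omega
    · rw [if_neg h, add_zero]
      refine ih ?_
      rw [walk_succ] at hk
      split_ifs at hk <;> omega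

theorem sum_visits_le (t : ℕ) (n : ℤ) (L : ℕ) :
    ∑ s ∈ Finset.range L, visits ξ t (n - s) ≤ t := by
  induction t with
  | zero => simp [visits, walkHist]
  | succ t ih =>
    simp only [visits_succ, Finset.sum_add_distrib]
    refine Nat.add_le_add ih ?_
    rw [Finset.sum_boole, Nat.cast_id, Finset.card_le_one]
    intro a ha b hb
    have h1 := (Finset.mem_filter.1 ha).2
    have h2 := (Finset.mem_filter.1 hb).2
    omega

theorem le_sum_visits {t : ℕ} {n : ℤ} {L : ℕ}
    (h : ∀ r < t, ∃ s < L, walk ξ r = n - s) :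
    t ≤ ∑ s ∈ Finset.range L, visits ξ t (n - s) := by
  induction t with
  | zero => exact Nat.zero_le _
  | succ t ih =>
    simp only [visits_succ, Finset.sum_add_distrib]
    refine Nat.add_le_add (ih fun r hr => h r (by omega)) ?_
    obtain ⟨s, hs, hw⟩ := h t (by omega)
    refine le_trans ?_ (Finset.single_le_sum (f := fun s : ℕ => if walk ξ t = n - s then 1 else 0)
      (fun _ _ => Nat.zero_le _) (Finset.mem_range.2 hs))
    simp [hw]

variable {ξ}

theorem CrossingEvent.le_leftSteps {n t : ℕ} (hX : (n : ℤ) ≤ walk ξ t) {s j : ℕ} (hs : s ≤ n)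
    (hj : CrossingEvent ξ n s j) : j ≤ leftSteps ξ t (n - s) := by
  induction s generalizing j with
  | zero => exact hj.trans_le (Nat.zero_le _)
  | succ s ih =>
    obtain ⟨i, hi, hhit⟩ := hj
    have h1 := ih (by omega) hi
    have h2 := rightSteps_add_eq ξ t (n - s - 1)
    rw [if_neg (by omega), if_pos (by omega), sub_add_cancel] at h2
    have h3 := hhit.le_failures (D := visits ξ t (n - s - 1))
      (show _ ≤ rightSteps ξ t (n - s - 1) by omega)
    have h4 := rightSteps_add_leftSteps ξ t (n - s - 1)
    change rightSteps ξ t (n - s - 1) + j ≤ _ at h3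
    rw [show (n : ℤ) - (s + 1 : ℕ) = n - s - 1 by push_cast; ring]
    omega

theorem CrossingEvent.leftSteps_le {n : ℤ} {t : ℕ} (hX : ∀ r < t, walk ξ r < n) {s j : ℕ}
    (hj : CrossingEvent ξ n s j) : leftSteps ξ t (n - s) ≤ j := by
  induction s generalizing j with
  | zero =>
    have : visits ξ t n = 0 := by
      clear hj
      induction t with
      | zero => rfl
      | succ t ih =>
        rw [visits_succ, ih fun r hr => hX r (by omega), if_neg (hX t (by omega)).ne]
    have h := rightSteps_add_leftSteps ξ t n
    simp only [Nat.cast_zero, sub_zero]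
    omega
  | succ s ih =>
    obtain ⟨i, hi, hhit⟩ := hj
    have h1 := ih hi
    have h2 := rightSteps_add_eq ξ t (n - s - 1)
    rw [sub_add_cancel] at h2
    have h3 := hhit.failures_le (D := visits ξ t (n - s - 1))
      (show rightSteps ξ t (n - s - 1) ≤ _ by split_ifs at h2 <;> omega)
      (fun h => visits_eq_zero_or_last_step_right ξ (by
        change rightSteps ξ t (n - s - 1) = _ at h
        by_contra hlt
        rw [if_neg hlt] at h2
        omega))
    have h4 := rightSteps_add_leftSteps ξ t (n - s - 1)
    change _ ≤ rightSteps ξ t (n - s - 1) + j at h3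
    rw [show n - (s + 1 : ℕ) = n - s - 1 by push_cast; ring]
    omega

theorem sum_crossing_le {n t : ℕ} (hX : (n : ℤ) ≤ walk ξ t) {V : ℕ → ℕ}
    (hV : ∀ s, CrossingEvent ξ n s (V s)) : ∑ s ∈ Finset.range n, V (s + 1) ≤ t := by
  refine le_trans (Finset.sum_le_sum fun s hs => ?_) (sum_visits_le ξ t (n - 1) n)
  have h1 := CrossingEvent.le_leftSteps hX (Finset.mem_range.1 hs) (hV (s + 1))
  have h2 := rightSteps_add_leftSteps ξ t (n - 1 - s)
  rw [show (n : ℤ) - (s + 1 : ℕ) = n - 1 - s by push_cast; ring] at h1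
  omega

theorem le_sum_crossing {n t : ℕ} (hX : ∀ r < t, |walk ξ r| < n) {V : ℕ → ℕ}
    (hV : ∀ s, CrossingEvent ξ n s (V s)) :
    t ≤ ∑ s ∈ Finset.range (2 * n), (V s + V (s + 1) + 1) := by
  refine (le_sum_visits ξ (n := n - 1) (L := 2 * n) fun r hr => ?_).trans
    (Finset.sum_le_sum fun s _ => ?_)
  · have := abs_lt.1 (hX r hr)
    exact ⟨(n - 1 - walk ξ r).toNat, by omega, by omega⟩
  · have hX' : ∀ r < t, walk ξ r < n := fun r hr => (abs_lt.1 (hX r hr)).2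
    have h0 := CrossingEvent.leftSteps_le hX' (hV s)
    have h1 := CrossingEvent.leftSteps_le hX' (hV (s + 1))
    have h2 := rightSteps_add_leftSteps ξ t (n - 1 - s)
    have h3 := rightSteps_add_eq ξ t (n - 1 - s)
    rw [show (n : ℤ) - (s + 1 : ℕ) = n - 1 - s by push_cast; ring] at h1
    rw [show (n : ℤ) - 1 - s + 1 = n - s by ring] at h3
    split_ifs at h3 <;> omega

theorem walkHist_reflect (ξ : ℤ → ℕ → Bool) (t : ℕ) :
    walkHist (fun x j => !ξ (-x) j) t = (walkHist ξ t).map Neg.neg := by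
  induction t with
  | zero => simp [walkHist]
  | succ t ih =>
    have h : walkHist ξ t = walk ξ t :: (walkHist ξ t).tail := walkHist_eq_cons ξ t
    simp only [walkHist, List.map_cons, ih, ← List.map_tail]
    rw [h]
    simp only [List.map_cons, List.headI_cons, List.tail_cons, neg_neg,
      List.count_map_of_injective _ _ neg_injective]
    congr 1
    by_cases h' : ξ (walk ξ t) (List.count (walk ξ t) (walkHist ξ t).tail) = true <;>
      simp [h'] <;> ring

theorem walk_reflect (ξ : ℤ → ℕ → Bool) (t : ℕ) :
    walk (fun x j => !ξ (-x) j) t = -walk ξ t := by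
  rw [walk, walkHist_reflect, walkHist_eq_cons ξ t]
  rfl

end Walk

section Velocity

theorem exists_lt_measure_of_eventually {Ω : Type*} [MeasurableSpace Ω] {Pm : Measure Ω}
    {Q : ℕ → Ω → Prop} (h : Pm {ω | ∀ᶠ n in atTop, Q n ω} = 1) {c : ENNReal} (hc : c < 1) :
    ∃ T, c < Pm {ω | ∀ n ≥ T, Q n ω} := by
  have hmono : Monotone fun T : ℕ => {ω | ∀ n ≥ T, Q n ω} :=
    fun T T' hT ω hω n hn => hω n (hT.trans hn)
  have hset : {ω | ∀ᶠ n in atTop, Q n ω} = ⋃ T : ℕ, {ω | ∀ n ≥ T, Q n ω} := by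
    ext ω
    simp [eventually_atTop]
  rw [hset, hmono.measure_iUnion] at h
  exact lt_iSup_iff.1 (h ▸ hc)

theorem tsum_mul_natCast_le_of_truncated {w : ℕ → ENNReal} {B : ENNReal}
    (h : ∀ M : ℕ, ∑' j : ℕ, w j * min (j : ENNReal) (M + 1 : ℕ) ≤ B) :
    ∑' j : ℕ, w j * j ≤ B := by
  rw [ENNReal.tsum_eq_iSup_sum]
  refine iSup_le fun F => ?_
  refine le_trans ?_ ((ENNReal.sum_le_tsum F).trans (h (F.sup id)))
  refine Finset.sum_le_sum fun j hj => ?_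
  rw [min_eq_left]
  exact_mod_cast (Finset.le_sup (f := id) hj).trans (Nat.le_succ _)

variable {N : ℕ} {Ω : Type*} [MeasurableSpace Ω] {Pm : Measure Ω}
  {K : Matrix (Fin N) (Fin N) ℝ} {μ p η : Fin N → ℝ}
  {Rc : ℤ → ℕ → Ω → Fin N} {ξ : ℤ → ℕ → Ω → Bool}

/-- If the walk has reached `n` by time `C n` for all large `n`, the mean number of crossings stays
bounded. -/
theorem IsCookieEnv.mean_le_of_eventually_le [IsProbabilityMeasure Pm]
    (henv : IsCookieEnv Pm K p η Rc ξ) (hK : IsStochastic K)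
    (hp : ∀ i, p i ∈ Set.Ioo (0 : ℝ) 1) (hη : IsProbVec η) {C : ℕ}
    (h : Pm {ω | ∀ᶠ n : ℕ in atTop, (n : ℤ) ≤ walk (fun x j => ξ x j ω) (C * n)} = 1) (s : ℕ) :
    ∑' j : ℕ, chainLaw (branchKernel K p η) s j * j ≤ 2 * (C + 1) := by
  refine tsum_mul_natCast_le_of_truncated fun M => ?_
  set φ : ℕ → ENNReal := fun j => min (j : ENNReal) (M + 1 : ℕ) with hφ
  have hφmono : Monotone φ := fun i j hij => min_le_min_right _ (Nat.cast_le.2 hij)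
  have hM0 : ((M + 1 : ℕ) : ENNReal) ≠ 0 := by simp
  obtain ⟨T, hT⟩ := exists_lt_measure_of_eventually h
    (ENNReal.sub_lt_self ENNReal.one_ne_top one_ne_zero
      (ENNReal.inv_ne_zero.2 (ENNReal.natCast_ne_top (M + 1))))
  set k := s + T + 1 with hk
  set n := 2 * k with hn
  have hint := fun r => henv.lintegral_crossingValue hK hp hη φ n r
  set f : Ω → ENNReal := fun ω =>
    ∑ r ∈ Finset.range n, crossingValue φ (fun x j => ξ x j ω) n (r + 1) with hf
  have hfm : Measurable f := Finset.measurable_sum _ fun r _ => (hint (r + 1)).1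
  have hgood := henv.ae_exists_crossingEvent hK hp hη
  set G : Set Ω := {ω | f ω ≤ C * n} with hG
  have hGm : MeasurableSet G := measurableSet_le hfm measurable_const
  have hBG : Pm {ω | ∀ n ≥ T, (n : ℤ) ≤ walk (fun x j => ξ x j ω) (C * n)} ≤ Pm G := by
    refine measure_mono_ae ?_
    filter_upwards [hgood] with ω hω hB
    choose V hV using hω n
    have h1 := sum_crossing_le (hB n (by omega)) hV
    change f ω ≤ _
    calc f ω = ∑ r ∈ Finset.range n, φ (V (r + 1)) :=
          Finset.sum_congr rfl fun r _ => (hV (r + 1)).value_eq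
      _ ≤ ∑ r ∈ Finset.range n, (V (r + 1) : ENNReal) :=
          Finset.sum_le_sum fun r _ => min_le_left _ _
      _ ≤ C * n := by exact_mod_cast h1
  have hGc : Pm Gᶜ * (M + 1 : ℕ) ≤ 1 := by
    rw [← ENNReal.le_div_iff_mul_le (Or.inl hM0) (Or.inl (ENNReal.natCast_ne_top _)), one_div,
      prob_compl_eq_one_sub hGm, tsub_le_iff_left, ← tsub_le_iff_right]
    exact hT.le.trans hBG
  have hupper : ∫⁻ ω, f ω ∂Pm ≤ (C + 1) * n := by
    calc ∫⁻ ω, f ω ∂Pm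
        ≤ ∫⁻ ω, ((C * n : ENNReal) + Gᶜ.indicator (fun _ => (n * (M + 1 : ℕ) : ENNReal)) ω) ∂Pm := by
          refine lintegral_mono_ae ?_
          filter_upwards [hgood] with ω hω
          by_cases hωG : ω ∈ G
          · exact le_add_right hωG
          · refine le_add_left ?_
            rw [Set.indicator_of_mem (Set.mem_compl hωG)]
            choose V hV using hω n
            calc f ω ≤ ∑ r ∈ Finset.range n, ((M + 1 : ℕ) : ENNReal) :=
                  Finset.sum_le_sum fun r _ => (hV (r + 1)).value_eq.trans_le (min_le_right _ _)
              _ = n * (M + 1 : ℕ) := by rw [Finset.sum_const, Finset.card_range, nsmul_eq_mul]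
      _ = C * n + n * (Pm Gᶜ * (M + 1 : ℕ)) := by
          rw [lintegral_add_left measurable_const, lintegral_indicator_const hGm.compl,
            lintegral_const, measure_univ, mul_one, mul_right_comm, mul_assoc]
      _ ≤ (C + 1) * n := by
          rw [add_mul, one_mul]
          gcongr
          exact mul_le_of_le_one_right' hGc
  have hmono := henv.monotone_truncated_mean hK hp hη hφmono
  have hlower : k * ∑' j : ℕ, chainLaw (branchKernel K p η) s j * φ j ≤ ∫⁻ ω, f ω ∂Pm := by
    rw [hf, lintegral_finsetSum _ fun r _ => (hint (r + 1)).1]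
    simp only [(hint _).2]
    rw [hn, two_mul, Finset.sum_range_add]
    refine le_add_left ?_
    rw [← nsmul_eq_mul]
    calc _ = ∑ r ∈ Finset.range k, ∑' j : ℕ, chainLaw (branchKernel K p η) s j * φ j := by simp
      _ ≤ _ := Finset.sum_le_sum fun r _ => hmono (by omega)
  have hk0 : (k : ENNReal) ≠ 0 := by simp [hk]
  refine (ENNReal.mul_le_mul_iff_right hk0 (ENNReal.natCast_ne_top k)).1
    ((hlower.trans hupper).trans_eq ?_)
  rw [hn]
  push_cast
  ring

theorem abs_walk_le (ζ : ℤ → ℕ → Bool) (t : ℕ) : |walk ζ t| ≤ t := by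
  induction t with
  | zero => simp [walk, walkHist]
  | succ t ih =>
    rw [walk_succ]
    rw [abs_le] at ih ⊢
    push_cast
    split_ifs <;> omega

theorem IsCookieEnv.velocity_nonpos [IsProbabilityMeasure Pm]
    (henv : IsCookieEnv Pm K p η Rc ξ) (hK : IsStochastic K) (hμ : HasUniqueStationaryDist K μ)
    (hp : ∀ i, p i ∈ Set.Ioo (0 : ℝ) 1) (hη : IsProbVec η) (hcrit : ∑ i, μ i * p i = 1 / 2)
    (hδ : deltaVal K μ p η ≤ 2) {v : ℝ}
    (hv : Pm {ω | Tendsto (fun n : ℕ => (walk (fun x j => ξ x j ω) n : ℝ) / n) atTop (nhds v)}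
      = 1) : v ≤ 0 := by
  by_contra! hpos
  obtain ⟨C, hC⟩ := exists_nat_gt (2 / v)
  have hCpos : 0 < C := by
    have : (0 : ℝ) < C := (by positivity : 0 < 2 / v).trans hC
    exact_mod_cast this
  rw [div_lt_iff₀ hpos] at hC
  obtain ⟨⟨φ, hφ0, hφ, hφsq, hsub⟩, c, hc⟩ := exists_subharmonic hK hμ hp hη hcrit hδ
  refine not_bounded_mean_of_subharmonic (tsum_branchKernel hK hp hη)
    (branchKernel_ne_zero hK hp hη) hφ0 hφ hφsq hsub hc (C := 2 * (C + 1))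
    (by finiteness) (henv.mean_le_of_eventually_le hK hp hη
      (le_antisymm prob_le_one (hv.ge.trans (measure_mono fun ω hω => ?_))))
  have hlim : ∀ᶠ t : ℕ in atTop, v / 2 < (walk (fun x j => ξ x j ω) t : ℝ) / t :=
    (show Tendsto _ _ _ from hω).eventually (lt_mem_nhds (half_lt_self hpos))
  have hCn : Tendsto (fun n : ℕ => C * n) atTop atTop := tendsto_id.const_mul_atTop' hCpos
  filter_upwards [hCn.eventually hlim, eventually_gt_atTop 0] with n hn hn0
  have hn0' : (0 : ℝ) < n := by exact_mod_cast hn0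
  have hC0' : (0 : ℝ) < C := by exact_mod_cast hCpos
  rw [Nat.cast_mul, lt_div_iff₀ (by positivity)] at hn
  have : (n : ℝ) ≤ walk (fun x j => ξ x j ω) (C * n) := by nlinarith
  exact_mod_cast this

/-- If the crossing chain has a Lyapunov function, the walk cannot stay below `n` in absolute value
up to time `L n` for all large `n`, once `L` is large. -/
theorem IsCookieEnv.not_forall_eventually_abs_lt [IsProbabilityMeasure Pm]
    (henv : IsCookieEnv Pm K p η Rc ξ) (hK : IsStochastic K)
    (hp : ∀ i, p i ∈ Set.Ioo (0 : ℝ) 1) (hη : IsProbVec η) {C : ENNReal} (hC : C ≠ ⊤)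
    (hmean : ∀ M : ℕ, ∑ s ∈ Finset.range M,
      ∑' j : ℕ, chainLaw (branchKernel K p η) s j * j ≤ C * M) :
    ¬ ∀ L : ℕ, Pm {ω | ∀ᶠ n : ℕ in atTop, ∀ r < L * n, |walk (fun x j => ξ x j ω) r| < n} = 1 := by
  intro h
  obtain ⟨L, hL⟩ := ENNReal.exists_nat_gt (show (2 * (6 * C + 2) : ENNReal) ≠ ⊤ by finiteness)
  obtain ⟨T, hT⟩ := exists_lt_measure_of_eventually (h L) (c := 1 / 2)
    (by rw [one_div]; exact ENNReal.one_half_lt_one)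
  set n := T + 1 with hn
  have hint := fun r => henv.lintegral_crossingValue hK hp hη (fun j => (j : ENNReal)) n r
  set f : Ω → ENNReal := fun ω => ∑ s ∈ Finset.range (2 * n),
    (crossingValue (fun j => (j : ENNReal)) (fun x j => ξ x j ω) n s +
      crossingValue (fun j => (j : ENNReal)) (fun x j => ξ x j ω) n (s + 1) + 1) with hf
  have hterm_meas : ∀ s, Measurable fun ω =>
      crossingValue (fun j => (j : ENNReal)) (fun x j => ξ x j ω) n s +
        crossingValue (fun j => (j : ENNReal)) (fun x j => ξ x j ω) n (s + 1) + 1 := fun s =>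
    ((hint s).1.add (hint (s + 1)).1).add measurable_const
  have hfm : Measurable f := Finset.measurable_sum _ fun s _ => hterm_meas s
  have hBG : Pm {ω | ∀ n ≥ T, ∀ r < L * n, |walk (fun x j => ξ x j ω) r| < n} ≤
      Pm {ω | ((L * n : ℕ) : ENNReal) ≤ f ω} := by
    refine measure_mono_ae ?_
    filter_upwards [henv.ae_exists_crossingEvent hK hp hη] with ω hω hB
    choose V hV using hω n
    have h1 := le_sum_crossing (hB n (by omega)) hV
    change _ ≤ f ω
    calc ((L * n : ℕ) : ENNReal)
        ≤ ((∑ s ∈ Finset.range (2 * n), (V s + V (s + 1) + 1) : ℕ) : ENNReal) := by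
          exact_mod_cast h1
      _ = f ω := by
          rw [hf]
          push_cast
          exact Finset.sum_congr rfl fun s _ => by rw [(hV s).value_eq, (hV (s + 1)).value_eq]
  have hintf : ∫⁻ ω, f ω ∂Pm ≤ (6 * C + 2) * n := by
    rw [lintegral_finsetSum _ fun s _ => hterm_meas s]
    have hterm : ∀ s, ∫⁻ ω, (crossingValue (fun j => (j : ENNReal)) (fun x j => ξ x j ω) n s +
        crossingValue (fun j => (j : ENNReal)) (fun x j => ξ x j ω) n (s + 1) + 1) ∂Pm =
        ∑' j : ℕ, chainLaw (branchKernel K p η) s j * j +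
          ∑' j : ℕ, chainLaw (branchKernel K p η) (s + 1) j * j + 1 := by
      intro s
      rw [lintegral_add_right _ measurable_const, lintegral_add_right _ (hint (s + 1)).1,
        (hint s).2, (hint (s + 1)).2]
      simp
    simp only [hterm, Finset.sum_add_distrib]
    have h2 : ∑ s ∈ Finset.range (2 * n), ∑' j : ℕ, chainLaw (branchKernel K p η) (s + 1) j * j ≤
        C * (2 * n + 1 : ℕ) := by
      refine le_trans ?_ (hmean _)
      rw [Finset.sum_range_succ']
      exact le_self_add
    calc _ ≤ C * (2 * n : ℕ) + C * (2 * n + 1 : ℕ) + (2 * n : ℕ) := by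
          refine add_le_add (add_le_add (hmean _) h2) ?_
          simp
      _ ≤ C * (2 * n : ℕ) + C * (4 * n : ℕ) + (2 * n : ℕ) := by
          gcongr
          omega
      _ = _ := by
          push_cast
          ring
  have hmarkov := mul_meas_ge_le_lintegral hfm (μ := Pm) ((L * n : ℕ) : ENNReal)
  have hn0 : (n : ENNReal) ≠ 0 := by simp [hn]
  have hfin : L * (1 / 2 : ENNReal) ≤ 6 * C + 2 := by
    refine (ENNReal.mul_le_mul_iff_left hn0 (ENNReal.natCast_ne_top n)).1 ?_
    calc (L * (1 / 2 : ENNReal)) * n = ((L * n : ℕ) : ENNReal) * (1 / 2) := by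
          push_cast
          ring
      _ ≤ ((L * n : ℕ) : ENNReal) * Pm {ω | ((L * n : ℕ) : ENNReal) ≤ f ω} :=
          mul_le_mul_right (hT.le.trans hBG) _
      _ ≤ _ := hmarkov.trans hintf
  refine hL.not_ge ?_
  calc (L : ENNReal) = 2 * (L * (1 / 2)) := by
        rw [mul_left_comm, one_div, ENNReal.mul_inv_cancel two_ne_zero ENNReal.ofNat_ne_top, mul_one]
    _ ≤ _ := mul_le_mul_right hfin _

theorem IsCookieEnv.velocity_ne_zero [IsProbabilityMeasure Pm]
    (henv : IsCookieEnv Pm K p η Rc ξ) (hK : IsStochastic K) (hμ : HasUniqueStationaryDist K μ)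
    (hp : ∀ i, p i ∈ Set.Ioo (0 : ℝ) 1) (hη : IsProbVec η) (hcrit : ∑ i, μ i * p i = 1 / 2)
    (hδ : 2 < deltaVal K μ p η) {v : ℝ}
    (hv : Pm {ω | Tendsto (fun n : ℕ => (walk (fun x j => ξ x j ω) n : ℝ) / n) atTop (nhds v)}
      = 1) : v ≠ 0 := by
  rintro rfl
  obtain ⟨ε, C, hε0, hε, hC, hlyap⟩ := exists_lyapunov hK hμ hp hη hcrit hδ
  refine henv.not_forall_eventually_abs_lt hK hp hη (C := C / ε) (ENNReal.div_ne_top hC hε0)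
    (fun M => ?_) fun L => le_antisymm prob_le_one (hv.ge.trans (measure_mono fun ω hω => ?_))
  · have := sum_mean_le_of_lyapunov (tsum_branchKernel hK hp hη) hlyap M
    rw [mul_comm, ← ENNReal.le_div_iff_mul_le (Or.inl hε0) (Or.inl hε)] at this
    rwa [ENNReal.mul_div_right_comm] at this
  · have hlim : ∀ᶠ t : ℕ in atTop, |(walk (fun x j => ξ x j ω) t : ℝ) / t| < 1 / (L + 1) := by
      have := (show Tendsto _ _ _ from hω).abs.eventually
        (gt_mem_nhds (show |(0 : ℝ)| < 1 / (L + 1) by rw [abs_zero]; positivity))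
      exact this
    obtain ⟨T, hT⟩ := eventually_atTop.1 hlim
    filter_upwards [eventually_gt_atTop T] with n hn r hr
    by_cases hrT : r < T
    · exact (abs_walk_le _ r).trans_lt (by omega)
    · rcases Nat.eq_zero_or_pos r with rfl | hr0
      · exact (abs_walk_le _ 0).trans_lt (by omega)
      have h1 := hT r (by omega)
      have hr0' : (0 : ℝ) < r := by exact_mod_cast hr0
      have hr' : (r : ℝ) < L * n := by exact_mod_cast hr
      rw [abs_div, abs_of_pos hr0', div_lt_div_iff₀ hr0' (by positivity)] at h1
      have h2 : (|walk (fun x j => ξ x j ω) r| : ℝ) < n := by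
        have h0 : (0 : ℝ) ≤ |(walk (fun x j => ξ x j ω) r : ℝ)| := abs_nonneg _
        by_contra! hge
        have : (L : ℝ) * n ≤ L * |(walk (fun x j => ξ x j ω) r : ℝ)| := by gcongr
        nlinarith
      exact_mod_cast h2

/-- Reflecting space exchanges the roles of right and left steps. -/
theorem IsCookieEnv.reflect (henv : IsCookieEnv Pm K p η Rc ξ) :
    IsCookieEnv Pm K (fun i => 1 - p i) η (fun x => Rc (-x)) (fun x j ω => !ξ (-x) j ω) := by
  obtain ⟨hR, hξ, hcyl⟩ := henv
  refine ⟨fun x j => hR _ _, fun x j => (measurable_from_top (f := not)).comp (hξ _ _),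
    fun S m f b => ?_⟩
  have h := hcyl (S.map (Equiv.neg ℤ).toEmbedding) m (fun x => f (-x)) (fun x j => !b (-x) j)
  simp only [Finset.prod_map, Finset.forall_mem_map, Equiv.coe_toEmbedding, Equiv.neg_apply,
    neg_neg] at h
  refine Eq.trans (congrArg (fun s => (Pm s).toReal) ?_)
    (h.trans (Finset.prod_congr rfl fun x _ => ?_))
  · ext ω
    exact forall₂_congr fun x _ => forall₂_congr fun j _ =>
      and_congr_right' Bool.not_eq_eq_eq_not
  · congr 1
    exact Finset.prod_congr rfl fun j _ => by cases b x j <;> simp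

theorem IsCookieEnv.velocity_pos_iff [IsProbabilityMeasure Pm]
    (henv : IsCookieEnv Pm K p η Rc ξ) (hK : IsStochastic K) (hμ : HasUniqueStationaryDist K μ)
    (hp : ∀ i, p i ∈ Set.Ioo (0 : ℝ) 1) (hη : IsProbVec η) (hcrit : ∑ i, μ i * p i = 1 / 2)
    {v : ℝ}
    (hv : Pm {ω | Tendsto (fun n : ℕ => (walk (fun x j => ξ x j ω) n : ℝ) / n) atTop (nhds v)}
      = 1)
    (hv' : Pm {ω | Tendsto (fun n : ℕ => (walk (fun x j => !ξ (-x) j ω) n : ℝ) / n) atTop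
      (nhds (-v))} = 1) :
    0 < v ↔ 2 < deltaVal K μ p η := by
  refine ⟨fun hpos => ?_, fun hδ => ?_⟩
  · by_contra! hδ
    exact (henv.velocity_nonpos hK hμ hp hη hcrit hδ hv).not_gt hpos
  · refine lt_of_le_of_ne ?_ (henv.velocity_ne_zero hK hμ hp hη hcrit hδ hv).symm
    have hν := nuVal_pos hK hμ hp hcrit
    have hsum := deltaVal_add_deltaVal_reflected hK hμ hp hcrit hη
    have : 0 < 2 / nuVal K μ p := by positivity
    have hneg := henv.reflect.velocity_nonpos hK hμ
      (fun i => ⟨sub_pos.2 (hp i).2, sub_lt_self 1 (hp i).1⟩) hη (sum_one_sub_of_crit hμ.1 hcrit)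
      (by linarith) hv'
    linarith

end Velocity

/-- **Theorem 1.4 (ballisticity criterion, critical case `p̄ = 1/2`).**
If `v₀` is the a.s. limiting velocity of the walk, then `v₀ > 0 ↔ δ > 2` and
`v₀ < 0 ↔ δ̃ > 2`. -/
theorem critical_ballisticity_criterion
    {N : ℕ} {Ω : Type*} [MeasurableSpace Ω] (Pm : Measure Ω) [IsProbabilityMeasure Pm]
    (K : Matrix (Fin N) (Fin N) ℝ) (μ p η : Fin N → ℝ)
    (Rc : ℤ → ℕ → Ω → Fin N) (ξ : ℤ → ℕ → Ω → Bool)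
    (hK : IsStochastic K) (hμ : HasUniqueStationaryDist K μ)
    (hp : ∀ i, p i ∈ Set.Ioo (0 : ℝ) 1) (hη : IsProbVec η)
    (henv : IsCookieEnv Pm K p η Rc ξ)
    (hcrit : ∑ i, μ i * p i = 1 / 2)
    (δ δtil : ℝ) (hδ : δ = deltaVal K μ p η) (hδtil : δtil = deltaVal K μ (fun i => 1 - p i) η)
    (v₀ : ℝ)
    (hv : Pm {ω | Tendsto (fun n : ℕ => (walk (fun x j => ξ x j ω) n : ℝ) / n) atTop (nhds v₀)}
      = 1) :
    (0 < v₀ ↔ 2 < δ) ∧ (v₀ < 0 ↔ 2 < δtil) := by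
  subst hδ hδtil
  have hp' : ∀ i, 1 - p i ∈ Set.Ioo (0 : ℝ) 1 := fun i =>
    ⟨sub_pos.2 (hp i).2, sub_lt_self 1 (hp i).1⟩
  have hv' : Pm {ω | Tendsto (fun n : ℕ => (walk (fun x j => !ξ (-x) j ω) n : ℝ) / n) atTop
      (nhds (-v₀))} = 1 := by
    refine le_antisymm prob_le_one (hv.ge.trans (measure_mono fun ω hω => ?_))
    have h := (show Tendsto _ _ _ from hω).neg
    refine (tendsto_congr fun n => ?_).2 h
    rw [walk_reflect fun x j => ξ x j ω, Int.cast_neg, neg_div]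
  refine ⟨henv.velocity_pos_iff hK hμ hp hη hcrit hv hv', ?_⟩
  rw [← neg_pos]
  refine henv.reflect.velocity_pos_iff hK hμ hp' hη (sum_one_sub_of_crit hμ.1 hcrit) hv' ?_
  simpa using hv

end
end

section
/- If n ≥ 1 and P_η(T_n < ∞) = 1, then the sequence (𝓓_n^n, 𝓓_n^{n−1}, …, 𝓓_n^1, 𝓓_n^0) under the averaged law P_η has the same distribution as (V_0, V_1, …, V_{n−1}, V_n) under P_η^{V,0}. -/
open MeasureTheory Filter Set Matrix ProbabilityTheory
open scoped Classical

noncomputable section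

/-- `numSucc ξx m` = number of successes before the `m`-th failure in the Bernoulli
sequence `ξx` (the quantity `S_m` of the paper). -/
def numSucc (ξx : ℕ → Bool) (m : ℕ) : ℕ :=
  sInf {k | ((Finset.range (k + m)).filter fun j => ξx j = false).card = m}

/-- `numFail ξx m` = number of failures before the `m`-th success in the Bernoulli
sequence `ξx` (the quantity `F_m` of the paper). -/
def numFail (ξx : ℕ → Bool) (m : ℕ) : ℕ :=
  sInf {k | ((Finset.range (k + m)).filter fun j => ξx j = true).card = m}

/-- The forward branching-like process: `U_0 = y`, `U_i = S^i_{U_{i−1}}`. -/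
def Uproc (ξ : ℤ → ℕ → Bool) (y : ℕ) : ℕ → ℕ
  | 0 => y
  | i + 1 => numSucc (ξ ((i : ℤ) + 1)) (Uproc ξ y i)

/-- The backward branching-like process: `V_0 = y`, `V_i = F^i_{V_{i−1}+1}`. -/
def Vproc (ξ : ℤ → ℕ → Bool) (y : ℕ) : ℕ → ℕ
  | 0 => y
  | i + 1 => numFail (ξ ((i : ℤ) + 1)) (Vproc ξ y i + 1)

/-- `downCond ξ n x k` says that time `k` is before `T_n` (the walk has not yet hit `n` by
time `k`) and the walk steps from `x` to `x − 1` at time `k`; thus `𝓓ₙˣ` is the number of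
`k` satisfying it. -/
def downCond (ξ : ℤ → ℕ → Bool) (n : ℤ) (x : ℤ) (k : ℕ) : Prop :=
  (∀ m ≤ k, walk ξ m ≠ n) ∧ walk ξ k = x ∧ walk ξ (k + 1) = x - 1

/-! ### Counting identities along a fixed trajectory -/

theorem walk_succ_s7 (ξ : ℤ → ℕ → Bool) (k : ℕ) :
    walk ξ (k + 1) = walk ξ k +
      (if ξ (walk ξ k) (Nat.count (fun m => walk ξ m = walk ξ k) k) then 1 else -1) := by
  have hcount : ∀ x k, (walkHist ξ k).tail.count x = Nat.count (fun m => walk ξ m = x) k := by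
    intro x k
    induction k with
    | zero => simp [walkHist]
    | succ k ih =>
      have hcons : walkHist ξ k = walk ξ k :: (walkHist ξ k).tail := by
        cases k <;> simp [walkHist, walk]
      have htail : (walkHist ξ (k + 1)).tail = walkHist ξ k := rfl
      rw [htail, hcons, List.count_cons, ih, Nat.count_succ]
      simp
  rw [← hcount]
  rfl

/-- The successes among the coins used at `x` before time `t` are the steps from `x`
to `x + 1`. -/
theorem count_coin_eq_count_up (ξ : ℤ → ℕ → Bool) (x : ℤ) (t : ℕ) :
    Nat.count (fun j => ξ x j = true) (Nat.count (fun k => walk ξ k = x) t) =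
      Nat.count (fun k => walk ξ k = x ∧ walk ξ (k + 1) = x + 1) t := by
  induction t with
  | zero => simp
  | succ t ih =>
    rw [Nat.count_succ (fun k => walk ξ k = x),
      Nat.count_succ (fun k => walk ξ k = x ∧ walk ξ (k + 1) = x + 1), ← ih]
    by_cases hx : walk ξ t = x
    · have hs := walk_succ_s7 ξ t
      rw [hx] at hs
      by_cases hb : ξ x (Nat.count (fun k => walk ξ k = x) t) = true
      · simp only [hb, if_true] at hs
        simp [hx, hs, Nat.count_succ, hb]
      · simp only [hb] at hs
        have hne : walk ξ (t + 1) ≠ x + 1 := by rw [hs]; simp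
        simp [hx, hne, Nat.count_succ, hb]
    · simp [hx]

theorem count_visit_eq_down_add_up (ξ : ℤ → ℕ → Bool) (x : ℤ) (t : ℕ) :
    Nat.count (fun k => walk ξ k = x) t =
      Nat.count (fun k => walk ξ k = x ∧ walk ξ (k + 1) = x - 1) t +
        Nat.count (fun k => walk ξ k = x ∧ walk ξ (k + 1) = x + 1) t := by
  induction t with
  | zero => simp
  | succ t ih =>
    have hs := walk_succ_s7 ξ t
    simp only [Nat.count_succ, ih]
    split_ifs at hs ⊢ <;> omega

/-- Up- and down-crossings of the edge `{x, x + 1}` balance when the walk starts weakly to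
the left of `x`. -/
theorem count_up_eq_count_down_add (ξ : ℤ → ℕ → Bool) {x : ℤ} (hx : 0 ≤ x) (t : ℕ) :
    Nat.count (fun k => walk ξ k = x ∧ walk ξ (k + 1) = x + 1) t =
      Nat.count (fun k => walk ξ k = x + 1 ∧ walk ξ (k + 1) = x + 1 - 1) t +
        if x + 1 ≤ walk ξ t then 1 else 0 := by
  induction t with
  | zero =>
    have h0 : ¬ x + 1 ≤ walk ξ 0 := by simp [walk, walkHist]; omega
    simp only [Nat.count_zero, if_neg h0]
  | succ t ih =>
    have hs := walk_succ_s7 ξ t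
    simp only [Nat.count_succ, ih]
    split_ifs at hs ⊢ <;> omega

/-- When the walk is to the right of `x`, the last coin used at `x` was a success. -/
theorem exists_last_coin_success (ξ : ℤ → ℕ → Bool) {x : ℤ} (hx : 0 ≤ x) (t : ℕ)
    (ht : x + 1 ≤ walk ξ t) :
    ∃ l, Nat.count (fun k => walk ξ k = x) t = l + 1 ∧ ξ x l = true := by
  induction t with
  | zero => simp [walk, walkHist] at ht; omega
  | succ t ih =>
    have hs := walk_succ_s7 ξ t
    by_cases hxt : walk ξ t = x
    · rw [hxt] at hs
      refine ⟨Nat.count (fun k => walk ξ k = x) t, by simp [Nat.count_succ, hxt], ?_⟩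
      by_contra hb
      simp only [hb] at hs
      simp at hs
      omega
    · rw [Nat.count_succ, if_neg hxt]
      apply ih
      split_ifs at hs <;> omega

theorem numFail_eq_of_success {y : ℕ → Bool} {m d l : ℕ} (hl : d + m = l + 1)
    (hy : y l = true) (hm : Nat.count (fun j => y j = true) (d + m) = m) :
    numFail y m = d := by
  unfold numFail
  simp only [← Nat.count_eq_card_filter_range]
  refine le_antisymm (Nat.sInf_le hm) (le_csInf ⟨d, hm⟩ fun k hk => ?_)
  by_contra! hkd
  have hmono : Nat.count (fun j => y j = true) (k + m) ≤ Nat.count (fun j => y j = true) l :=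
    Nat.count_monotone _ (by omega)
  rw [hl, Nat.count_succ, if_pos hy] at hm
  simp only [Set.mem_ofPred_eq] at hk
  omega

/-- The down-crossing counts of neighbouring edges, at a time when the walk is to the right
of both, are related by the backward branching recursion. -/
theorem count_down_eq_numFail (ξ : ℤ → ℕ → Bool) {x : ℤ} (hx : 0 ≤ x) {t : ℕ}
    (ht : x + 1 ≤ walk ξ t) :
    Nat.count (fun k => walk ξ k = x ∧ walk ξ (k + 1) = x - 1) t =
      numFail (ξ x)
        (Nat.count (fun k => walk ξ k = x + 1 ∧ walk ξ (k + 1) = x + 1 - 1) t + 1) := by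
  obtain ⟨l, hl, hb⟩ := exists_last_coin_success ξ hx t ht
  have hup := count_up_eq_count_down_add ξ hx t
  rw [if_pos ht] at hup
  rw [← hup]
  have hvisit := count_visit_eq_down_add_up ξ x t
  refine (numFail_eq_of_success (hvisit.symm.trans hl) hb ?_).symm
  rw [← hvisit, count_coin_eq_count_up]

theorem count_down_eq_Vproc (ξ : ℤ → ℕ → Bool) (n T : ℕ) (hT : walk ξ T = n)
    (hlt : ∀ k < T, walk ξ k ≠ n) (i : ℕ) (hi : i ≤ n) :
    Nat.count (fun k => walk ξ k = (n : ℤ) - i ∧ walk ξ (k + 1) = (n : ℤ) - i - 1) T =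
      Vproc (fun x => ξ ((n : ℤ) - x)) 0 i := by
  induction i with
  | zero =>
    rw [Nat.count_eq_card_filter_range]
    simp only [Vproc, Finset.card_eq_zero, Finset.filter_eq_empty_iff, Finset.mem_range]
    intro k hk h
    exact hlt k hk (by simpa using h.1)
  | succ i ih =>
    have hx : (0 : ℤ) ≤ (n : ℤ) - ((i + 1 : ℕ) : ℤ) := by omega
    rw [count_down_eq_numFail ξ hx (by rw [hT]; omega)]
    have he : (n : ℤ) - ((i + 1 : ℕ) : ℤ) + 1 = (n : ℤ) - i := by push_cast; ring
    rw [he, ih (by omega)]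
    simp only [Vproc, Nat.cast_add, Nat.cast_one]

theorem exists_downCond_finset_iff (ξ : ℤ → ℕ → Bool) (n : ℕ)
    (hT : ∃ k, walk ξ k = (n : ℤ)) (i : ℕ) (hi : i ≤ n) (a : ℕ) :
    (∃ s : Finset ℕ, (∀ k : ℕ, downCond ξ n ((n : ℤ) - i) k ↔ k ∈ s) ∧ s.card = a) ↔
      Vproc (fun x => ξ ((n : ℤ) - x)) 0 i = a := by
  rw [← count_down_eq_Vproc ξ n (Nat.find hT) (Nat.find_spec hT)
    (fun k hk => Nat.find_min hT hk) i hi, Nat.count_eq_card_filter_range]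
  have hmem : ∀ k, downCond ξ n ((n : ℤ) - i) k ↔ k ∈ (Finset.range (Nat.find hT)).filter
      (fun k => walk ξ k = (n : ℤ) - i ∧ walk ξ (k + 1) = (n : ℤ) - i - 1) := by
    intro k
    rw [Finset.mem_filter, Finset.mem_range, Nat.lt_find_iff]
    rfl
  constructor
  · rintro ⟨s, hs, rfl⟩
    congr 1
    ext k
    rw [← hmem, hs]
  · intro h
    exact ⟨_, hmem, h⟩

/-! ### Measurability -/

theorem measurableSet_walk_eq {Ω : Type*} [MeasurableSpace Ω] {ξ : ℤ → ℕ → Ω → Bool}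
    (hξ : ∀ x j, Measurable (ξ x j)) (k : ℕ) (a : ℤ) :
    MeasurableSet {ω | walk (fun x j => ξ x j ω) k = a} := by
  have hhist : ∀ k l, MeasurableSet {ω | walkHist (fun x j => ξ x j ω) k = l} := by
    intro k
    induction k with
    | zero => intro l; exact MeasurableSet.const ([0] = l)
    | succ k ih =>
      intro l
      have hset : {ω | walkHist (fun x j => ξ x j ω) (k + 1) = l} =
          ⋃ h : List ℤ, {ω | walkHist (fun x j => ξ x j ω) k = h} ∩
            (ξ h.headI (h.tail.count h.headI)) ⁻¹'
              {b | (h.headI + (if b then 1 else -1)) :: h = l} := by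
        ext ω
        simp [walkHist]
      rw [hset]
      exact MeasurableSet.iUnion fun h => (ih h).inter (hξ _ _ (MeasurableSet.of_discrete))
  have hset : {ω | walk (fun x j => ξ x j ω) k = a} =
      ⋃ h : {h : List ℤ // h.headI = a}, {ω | walkHist (fun x j => ξ x j ω) k = h} := by
    ext ω
    simp [walk]
  rw [hset]
  exact MeasurableSet.iUnion fun h => hhist k h

theorem measurable_nat_sInf {Ω : Type*} [MeasurableSpace Ω] {P : Ω → ℕ → Prop}
    (hP : ∀ k, MeasurableSet {ω | P ω k}) : Measurable fun ω => sInf {k | P ω k} := by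
  refine measurable_to_countable' fun a => ?_
  have hset : (fun ω => sInf {k | P ω k}) ⁻¹' {a} =
      {ω | (P ω a ∧ ∀ k < a, ¬ P ω k) ∨ (a = 0 ∧ ∀ k, ¬ P ω k)} := by
    ext ω
    simp only [Set.mem_preimage, Set.mem_singleton_iff, Set.mem_ofPred_eq]
    constructor
    · rintro rfl
      by_cases hne : {k | P ω k}.Nonempty
      · exact Or.inl ⟨Nat.sInf_mem hne, fun k hk => Nat.notMem_of_lt_sInf hk⟩
      · rw [Set.not_nonempty_iff_eq_empty] at hne
        refine Or.inr ⟨by rw [hne]; simp, fun k hk => ?_⟩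
        have : k ∈ {k | P ω k} := hk
        rw [hne] at this
        exact this
    · rintro (⟨ha, hlt⟩ | ⟨rfl, hk⟩)
      · refine le_antisymm (Nat.sInf_le ha) (le_csInf ⟨a, ha⟩ fun k hk => ?_)
        by_contra! hka
        exact hlt k hka hk
      · simp [hk]
  rw [hset]
  have hlt : MeasurableSet {ω | ∀ k < a, ¬ P ω k} := by
    simp only [Set.ofPred_forall]
    exact MeasurableSet.iInter fun k => MeasurableSet.iInter fun _ => (hP k).compl
  have hall : MeasurableSet {ω | ∀ k, ¬ P ω k} := by
    simp only [Set.ofPred_forall]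
    exact MeasurableSet.iInter fun k => (hP k).compl
  exact ((hP a).inter hlt).union ((MeasurableSet.const (a = 0)).inter hall)

theorem measurable_numFail {Ω : Type*} [MeasurableSpace Ω] {y : Ω → ℕ → Bool}
    (hy : ∀ j, Measurable fun ω => y ω j) (m : ℕ) : Measurable fun ω => numFail (y ω) m := by
  refine measurable_nat_sInf fun k => ?_
  simp only [Finset.card_filter]
  have hsum : Measurable fun ω => ∑ j ∈ Finset.range (k + m), if y ω j = true then 1 else 0 :=
    Finset.measurable_sum _ fun j _ =>
      Measurable.ite (hy j (measurableSet_singleton true)) measurable_const measurable_const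
  exact hsum (measurableSet_singleton m)

theorem measurable_Vproc {Ω : Type*} [MeasurableSpace Ω] {ξ : Ω → ℤ → ℕ → Bool}
    (hξ : ∀ x j, Measurable fun ω => ξ ω x j) (a i : ℕ) :
    Measurable fun ω => Vproc (ξ ω) a i := by
  induction i with
  | zero => exact measurable_const
  | succ i ih =>
    refine measurable_to_countable' fun c => ?_
    have hset : (fun ω => Vproc (ξ ω) a (i + 1)) ⁻¹' {c} =
        ⋃ m, (fun ω => Vproc (ξ ω) a i) ⁻¹' {m} ∩
          (fun ω => numFail (ξ ω ((i : ℤ) + 1)) (m + 1)) ⁻¹' {c} := by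
      ext ω
      simp [Vproc]
    rw [hset]
    exact MeasurableSet.iUnion fun m => (ih (measurableSet_singleton m)).inter
      (measurable_numFail (fun j => hξ _ j) _ (measurableSet_singleton c))

/-! ### Laws of doubly indexed arrays with finite alphabet -/

theorem measurableSet_window {α : Type*} [MeasurableSpace α] [MeasurableSingletonClass α]
    (S : Finset ℤ) (m : ℕ) (b : ℤ → ℕ → α) :
    MeasurableSet {y : ℤ → ℕ → α | ∀ x ∈ S, ∀ j ≤ m, y x j = b x j} := by
  have hcoord : ∀ x j, MeasurableSet {y : ℤ → ℕ → α | y x j = b x j} := fun x j =>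
    have hm : Measurable fun y : ℤ → ℕ → α => y x j :=
      (measurable_pi_apply j).comp (measurable_pi_apply x)
    hm (measurableSet_singleton (b x j))
  simp only [Set.ofPred_forall]
  exact MeasurableSet.iInter fun x => MeasurableSet.iInter fun _ => MeasurableSet.iInter
    fun j => MeasurableSet.iInter fun _ => hcoord x j

/-- A probability measure on arrays indexed by `ℤ × ℕ` over a finite alphabet is determined by the
masses of the cylinders fixing all entries in a window `[-m, m] × [0, m]`. -/
theorem measure_ext_of_window {α : Type*} [Finite α] [MeasurableSpace α]
    [MeasurableSingletonClass α] (μ ν : Measure (ℤ → ℕ → α)) [IsProbabilityMeasure μ]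
    [IsProbabilityMeasure ν]
    (h : ∀ (m : ℕ) (b : ℤ → ℕ → α),
      μ {y | ∀ x ∈ Finset.Icc (-(m : ℤ)) m, ∀ j ≤ m, y x j = b x j} =
        ν {y | ∀ x ∈ Finset.Icc (-(m : ℤ)) m, ∀ j ≤ m, y x j = b x j}) : μ = ν := by
  let cyl : ℕ → (ℤ → ℕ → α) → Set (ℤ → ℕ → α) := fun m b =>
    {y | ∀ x ∈ Finset.Icc (-(m : ℤ)) m, ∀ j ≤ m, y x j = b x j}
  let C : Set (Set (ℤ → ℕ → α)) := {s | ∃ m b, s = cyl m b}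
  have hanti : ∀ {m m' b b'}, m ≤ m' → (cyl m b ∩ cyl m' b').Nonempty →
      cyl m b ∩ cyl m' b' = cyl m' b' := by
    rintro m m' b b' hmm ⟨z, hz, hz'⟩
    refine Set.inter_eq_right.2 fun y hy x hx j hj => ?_
    have hx' : x ∈ Finset.Icc (-(m' : ℤ)) m' := by
      rw [Finset.mem_Icc] at hx ⊢
      omega
    rw [hy x hx' j (hj.trans hmm), ← hz' x hx' j (hj.trans hmm), hz x hx j hj]
  have hpi : IsPiSystem C := by
    rintro _ ⟨m, b, rfl⟩ _ ⟨m', b', rfl⟩ hne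
    rcases le_total m m' with hmm | hmm
    · exact ⟨m', b', hanti hmm hne⟩
    · rw [Set.inter_comm] at hne ⊢
      exact ⟨m, b, hanti hmm hne⟩
  have hgen : (inferInstance : MeasurableSpace (ℤ → ℕ → α)) =
      MeasurableSpace.generateFrom C := by
    refine le_antisymm ?_ (MeasurableSpace.generateFrom_le ?_)
    · have hcoord : ∀ x j, Measurable[MeasurableSpace.generateFrom C]
          (fun y : ℤ → ℕ → α => y x j) := by
        intro x j
        let m := max x.natAbs j
        let w : (ℤ → ℕ → α) → (Finset.Icc (-(m : ℤ)) m → Fin (m + 1) → α) :=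
          fun y x j => y x j
        have hw : Measurable[MeasurableSpace.generateFrom C] w := by
          let := MeasurableSpace.generateFrom C
          refine measurable_to_countable' fun t => ?_
          rcases (w ⁻¹' {t}).eq_empty_or_nonempty with he | ⟨z, hz⟩
          · rw [he]; exact MeasurableSet.empty
          · have hset : w ⁻¹' {t} = cyl m z := by
              rw [Set.mem_preimage, Set.mem_singleton_iff] at hz
              ext y
              rw [Set.mem_preimage, Set.mem_singleton_iff, ← hz]
              constructor
              · intro hy x hx j hj
                exact congrFun (congrFun hy ⟨x, hx⟩) ⟨j, by omega⟩
              · intro hy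
                funext x j
                exact hy x x.2 j (by omega)
            rw [hset]
            exact MeasurableSpace.measurableSet_generateFrom ⟨m, z, rfl⟩
        have hx : x ∈ Finset.Icc (-(m : ℤ)) m := by
          rw [Finset.mem_Icc]
          omega
        have hj : j < m + 1 := by omega
        exact ((measurable_pi_apply (⟨j, hj⟩ : Fin (m + 1))).comp
          (measurable_pi_apply (⟨x, hx⟩ : Finset.Icc (-(m : ℤ)) m))).comp hw
      have hid : Measurable[MeasurableSpace.generateFrom C] (fun y : ℤ → ℕ → α => y) := by
        let := MeasurableSpace.generateFrom C
        exact @measurable_pi_lambda _ _ _ (MeasurableSpace.generateFrom C) _ _ fun x =>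
          @measurable_pi_lambda _ _ _ (MeasurableSpace.generateFrom C) _ _ fun j => hcoord x j
      intro s hs
      exact hid hs
    · rintro _ ⟨m, b, rfl⟩
      exact measurableSet_window _ m b
  refine ext_of_generate_finite C hgen hpi ?_ (by simp)
  rintro _ ⟨m, b, rfl⟩
  exact h m b

/-- The law of a cookie environment with its coins is invariant under reindexing the sites. -/
theorem IsCookieEnv.map_comp_injective {N : ℕ} {Ω : Type*} [MeasurableSpace Ω] {Pm : Measure Ω}
    [IsProbabilityMeasure Pm] {K : Matrix (Fin N) (Fin N) ℝ} {p η : Fin N → ℝ}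
    {Rc : ℤ → ℕ → Ω → Fin N} {ξ : ℤ → ℕ → Ω → Bool} (henv : IsCookieEnv Pm K p η Rc ξ)
    {e : ℤ → ℤ} (he : Function.Injective e) :
    Pm.map (fun ω x j => (Rc (e x) j ω, ξ (e x) j ω)) =
      Pm.map (fun ω x j => (Rc x j ω, ξ x j ω)) := by
  obtain ⟨hR, hξ, hcyl⟩ := henv
  have hmeas : ∀ e : ℤ → ℤ, Measurable (fun ω x j => (Rc (e x) j ω, ξ (e x) j ω)) := fun e =>
    measurable_pi_lambda _ fun x => measurable_pi_lambda _ fun j =>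
      (hR (e x) j).prodMk (hξ (e x) j)
  have hprob : ∀ {e : ℤ → ℤ}, Function.Injective e → ∀ (m : ℕ) (b : ℤ → ℕ → Fin N × Bool),
      (Pm.map (fun ω x j => (Rc (e x) j ω, ξ (e x) j ω))
        {y | ∀ x ∈ Finset.Icc (-(m : ℤ)) m, ∀ j ≤ m, y x j = b x j}).toReal =
        ∏ x ∈ Finset.Icc (-(m : ℤ)) m,
          (η (b x 0).1 * (∏ j ∈ Finset.range m, K (b x j).1 (b x (j + 1)).1) *
            ∏ j ∈ Finset.range (m + 1),
              (if (b x j).2 then p (b x j).1 else 1 - p (b x j).1)) := by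
    intro e he m b
    have hinv := Function.leftInverse_invFun he
    rw [Measure.map_apply (hmeas e)]
    · have hc := hcyl ((Finset.Icc (-(m : ℤ)) m).image e) m
        (fun x j => (b (Function.invFun e x) j).1) (fun x j => (b (Function.invFun e x) j).2)
      rw [Finset.prod_image fun _ _ _ _ h => he h] at hc
      simp only [Finset.forall_mem_image, hinv _] at hc
      rw [← hc]
      simp only [Set.preimage_ofPred_eq, Prod.ext_iff]
    · exact measurableSet_window _ m b
  have := Measure.isProbabilityMeasure_map (μ := Pm) (hmeas e).aemeasurable
  have := Measure.isProbabilityMeasure_map (μ := Pm) (hmeas id).aemeasurable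
  refine measure_ext_of_window _ (Pm.map (fun ω x j => (Rc (id x) j ω, ξ (id x) j ω)))
    fun m b => ?_
  rw [← ENNReal.toReal_eq_toReal_iff' (measure_ne_top _ _) (measure_ne_top _ _), hprob he,
    hprob Function.injective_id]

/-- **Lemma 2.2.** If `n ≥ 1` and `P_η(T_n < ∞) = 1`, then under the averaged law the
sequence `(𝓓ₙⁿ, 𝓓ₙ^{n−1}, …, 𝓓ₙ⁰)` of left-directed edge local times at time `T_n` has the
same distribution as `(V₀, V₁, …, Vₙ)`, the backward BLP started at `0`. (The value of
`𝓓ₙ^{n−i}` is expressed by exhibiting the finite set of its down-crossing times.) -/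
theorem edge_local_times_eq_backward_BLP_in_distribution
    {N : ℕ} {Ω : Type*} [MeasurableSpace Ω] (Pm : Measure Ω) [IsProbabilityMeasure Pm]
    (K : Matrix (Fin N) (Fin N) ℝ) (μ p η : Fin N → ℝ)
    (Rc : ℤ → ℕ → Ω → Fin N) (ξ : ℤ → ℕ → Ω → Bool)
    (hK : IsStochastic K) (hμ : HasUniqueStationaryDist K μ)
    (hp : ∀ i, p i ∈ Set.Ioo (0 : ℝ) 1) (hη : IsProbVec η)
    (henv : IsCookieEnv Pm K p η Rc ξ)
    (n : ℕ) (hn : 1 ≤ n)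
    (hT : Pm {ω | ∃ k, walk (fun x j => ξ x j ω) k = (n : ℤ)} = 1) :
    ∀ v : Fin (n + 1) → ℕ,
      Pm {ω | ∀ i : Fin (n + 1), ∃ s : Finset ℕ,
            (∀ k : ℕ, downCond (fun x j => ξ x j ω) n ((n : ℤ) - (i : ℕ)) k ↔ k ∈ s) ∧
            s.card = v i} =
        Pm {ω | ∀ i : Fin (n + 1), Vproc (fun x j => ξ x j ω) 0 i = v i} := by
  intro v
  have hξ := henv.2.1
  have hhit : ∀ᵐ ω ∂Pm, ∃ k, walk (fun x j => ξ x j ω) k = (n : ℤ) := by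
    rw [← prob_compl_eq_zero_iff] at hT
    · exact hT
    · simp only [Set.ofPred_exists]
      exact MeasurableSet.iUnion fun k => measurableSet_walk_eq hξ k n
  let A : Set (ℤ → ℕ → Fin N × Bool) :=
    {y | ∀ i : Fin (n + 1), Vproc (fun x j => (y x j).2) 0 i = v i}
  have hA : MeasurableSet A := by
    simp only [A, Set.ofPred_forall]
    exact MeasurableSet.iInter fun i => measurable_Vproc
      (fun x j => measurable_snd.comp ((measurable_pi_apply j).comp (measurable_pi_apply x)))
      0 i (measurableSet_singleton (v i))
  have hmeas : ∀ e : ℤ → ℤ, Measurable (fun ω x j => (Rc (e x) j ω, ξ (e x) j ω)) := fun e =>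
    measurable_pi_lambda _ fun x => measurable_pi_lambda _ fun j =>
      (henv.1 (e x) j).prodMk (hξ (e x) j)
  have hlaw := (Measure.map_apply (hmeas fun x => (n : ℤ) - x) hA).symm.trans
    ((congrArg (fun ρ => ρ A) (henv.map_comp_injective sub_right_injective)).trans
      (Measure.map_apply (hmeas id) hA))
  refine (measure_congr ?_).trans hlaw
  filter_upwards [hhit] with ω hω
  refine propext (forall_congr' fun i => ?_)
  exact exists_downCond_finset_iff (fun x j => ξ x j ω) n hω i (by omega) (v i)

end
end
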